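/- Let q be an odd prime power, d ≥ 2, and E ⊆ 𝔽_q^d with |E| ≥ (4k/ln 2)·q^{(d+1)/2}. Then G_k ≥ |E|^{k+1}/q^k − (4k/ln 2)·q^{(d+1)/2}·|E|^k/q^k, where G_k is the number of non-overlapping unit-distance paths of length k in E. -/

import Mathlib

/-- `G_k`: the number of non-overlapping unit-distance paths of length `k` in `E ⊆ 𝔽_q^d`,
i.e. tuples `(x^1, …, x^{k+1}) ∈ E^{k+1}` with pairwise distinct entries and
`‖x^i − x^{i+1}‖ = 1` for `1 ≤ i ≤ k`, where `‖x‖ = x_1^2 + ⋯ + x_d^2`. -/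
def pathCount {F : Type} [Field F] [Fintype F] [DecidableEq F] {d : ℕ}
    (E : Finset (Fin d → F)) (k : ℕ) : ℕ :=
  (Finset.univ.filter (fun x : Fin (k + 1) → (Fin d → F) =>
    Function.Injective x ∧ (∀ i, x i ∈ E) ∧
      ∀ i : Fin k, ∑ j, (x i.castSucc j - x i.succ j) ^ 2 = 1)).card


namespace KL

section stepanov
variable {K : Type} [Field K]

/-- points of the curve `z^q = z + a x + b / x - e`, `x ≠ 0` -/
def Pt (q : ℕ) (a b e : K) : Type :=
  {xz : K × K // xz.1 ≠ 0 ∧ xz.2 ^ q = xz.2 + a * xz.1 + b * xz.1⁻¹ - e}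

/-- the monomial of weight `v` -/
def mon (q : ℕ) (a b e : K) (v : ℤ) : Pt q a b e → K :=
  fun t => t.1.1 ^ (v / q) * t.1.2 ^ (v % q).toNat

/-- span of monomials of weights between `lo` and `hi` -/
def Sp (q : ℕ) (a b e : K) (lo hi : ℤ) : Submodule K (Pt q a b e → K) :=
  Submodule.span K (mon q a b e '' Set.Icc lo hi)

def Lead (q : ℕ) (a b e : K) (lo hi : ℤ) (φ : Pt q a b e → K) : Prop :=
  ∃ u : K, u ≠ 0 ∧ φ - u • mon q a b e hi ∈ Sp q a b e lo (hi - 1)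

variable {q : ℕ} {a b e : K}

lemma mon_mem {lo hi v : ℤ} (h1 : lo ≤ v) (h2 : v ≤ hi) : mon q a b e v ∈ Sp q a b e lo hi :=
  Submodule.subset_span ⟨v, ⟨h1, h2⟩, rfl⟩

lemma Sp_mono {lo hi lo' hi' : ℤ} (h1 : lo' ≤ lo) (h2 : hi ≤ hi') :
    Sp q a b e lo hi ≤ Sp q a b e lo' hi' :=
  Submodule.span_mono (Set.image_mono (Set.Icc_subset_Icc h1 h2))

lemma mon_eq (hq : 0 < q) (i : ℤ) (j : ℕ) (hj : j < q) :
    mon q a b e (q * i + j) = fun t => t.1.1 ^ i * t.1.2 ^ j := by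
  have hq' : (q : ℤ) ≠ 0 := by positivity
  have h1 : ((q : ℤ) * i + j) / q = i := by
    rw [add_comm, Int.add_mul_ediv_left _ _ hq', Int.ediv_eq_zero_of_lt (by positivity) (by exact_mod_cast hj)]
    simp
  have h2 : ((q : ℤ) * i + j) % q = j := by
    rw [add_comm, Int.add_mul_emod_self_left, Int.emod_eq_of_lt (by positivity) (by exact_mod_cast hj)]
  unfold mon
  rw [h1, h2]; simp

lemma exists_rep (hq : 0 < q) (v : ℤ) : ∃ (i : ℤ) (j : ℕ), j < q ∧ v = q * i + j := by
  have hq' : (q : ℤ) ≠ 0 := by positivity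
  refine ⟨v / q, (v % q).toNat, ?_, ?_⟩
  · have := Int.emod_lt_of_pos v (b := q) (by positivity)
    have := Int.emod_nonneg v hq'
    omega
  · have := Int.emod_nonneg v hq'
    have := Int.mul_ediv_add_emod v q
    omega

lemma mon_mul (hq : 2 ≤ q) (ha : a ≠ 0) (v w : ℤ) : ∃ u : K, u ≠ 0 ∧
    mon q a b e v * mon q a b e w - u • mon q a b e (v + w) ∈
      Sp q a b e (v + w - 2 * q) (v + w - 1) := by
  have hq0 : 0 < q := by omega
  obtain ⟨i, j, hj, rfl⟩ := exists_rep hq0 v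
  obtain ⟨i', j', hj', rfl⟩ := exists_rep hq0 w
  by_cases h : j + j' < q
  · refine ⟨1, one_ne_zero, ?_⟩
    have e1 : (q : ℤ) * i + j + (q * i' + j') = q * (i + i') + (j + j' : ℕ) := by push_cast; ring
    have : mon q a b e (q * i + j) * mon q a b e (q * i' + j') - (1 : K) • mon q a b e (q * i + j + (q * i' + j')) = 0 := by
      rw [e1, mon_eq hq0 _ _ hj, mon_eq hq0 _ _ hj', mon_eq hq0 _ _ h]
      funext t
      have hx := t.2.1
      simp only [Pi.mul_apply, Pi.sub_apply, Pi.smul_apply, smul_eq_mul, Pi.zero_apply]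
      rw [zpow_add₀ hx, pow_add]; ring
    rw [this]; exact Submodule.zero_mem _
  · obtain ⟨J, hJ⟩ : ∃ J, j + j' = q + J := ⟨j + j' - q, by omega⟩
    have hJq : J + 1 < q := by omega
    refine ⟨a, ha, ?_⟩
    have hJz : (j : ℤ) + j' = q + J := by exact_mod_cast hJ
    obtain ⟨I, hI⟩ : ∃ I, I = i + i' := ⟨_, rfl⟩
    have e1 : (q : ℤ) * i + j + (q * i' + j') = q * (I + 1) + J := by
      rw [hI]; linear_combination hJz
    have : mon q a b e (q * i + j) * mon q a b e (q * i' + j') - a • mon q a b e (q * i + j + (q * i' + j'))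
        = mon q a b e (q * I + (J + 1 : ℕ)) + b • mon q a b e (q * (I - 1) + J) - e • mon q a b e (q * I + J) := by
      rw [e1, mon_eq hq0 _ _ hj, mon_eq hq0 _ _ hj', mon_eq hq0 _ _ hJq, mon_eq hq0 _ J (by omega),
        mon_eq hq0 _ J (by omega), mon_eq hq0 _ J (by omega)]
      funext t
      have hx := t.2.1
      have hz := t.2.2
      simp only [Pi.mul_apply, Pi.sub_apply, Pi.smul_apply, smul_eq_mul, Pi.add_apply]
      have : t.1.1 ^ i * t.1.2 ^ j * (t.1.1 ^ i' * t.1.2 ^ j') = t.1.1 ^ I * t.1.2 ^ J * t.1.2 ^ q := by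
        rw [hI, zpow_add₀ hx]
        have : t.1.2 ^ j * t.1.2 ^ j' = t.1.2 ^ q * t.1.2 ^ J := by rw [← pow_add, hJ, pow_add]
        linear_combination (t.1.1 ^ i * t.1.1 ^ i') * this
      rw [this, hz, zpow_add₀ hx, zpow_sub₀ hx, zpow_one]
      field_simp
      ring
    rw [this, e1]
    have hqz : (2 : ℤ) ≤ q := by exact_mod_cast hq
    have hJ0 : (0 : ℤ) ≤ J := by positivity
    refine Submodule.sub_mem _ (Submodule.add_mem _ ?_ (Submodule.smul_mem _ _ ?_)) (Submodule.smul_mem _ _ ?_)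
    all_goals
      apply mon_mem <;> push_cast <;> nlinarith

lemma Sp_mul (hq : 2 ≤ q) (ha : a ≠ 0) {l1 h1 l2 h2 : ℤ} {φ ψ : Pt q a b e → K}
    (hφ : φ ∈ Sp q a b e l1 h1) (hψ : ψ ∈ Sp q a b e l2 h2) :
    φ * ψ ∈ Sp q a b e (l1 + l2 - 2 * q) (h1 + h2) := by
  have : Sp q a b e l1 h1 * Sp q a b e l2 h2 ≤ Sp q a b e (l1 + l2 - 2 * q) (h1 + h2) := by
    unfold Sp
    rw [Submodule.span_mul_span, Submodule.span_le]
    rintro _ ⟨_, ⟨v, hv, rfl⟩, _, ⟨w, hw, rfl⟩, rfl⟩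
    obtain ⟨u, -, hu⟩ := mon_mul (b := b) (e := e) hq ha v w
    have hv1 := hv.1
    have hv2 := hv.2
    have hw1 := hw.1
    have hw2 := hw.2
    have h3 : u • mon q a b e (v + w) ∈ Sp q a b e (l1 + l2 - 2 * q) (h1 + h2) :=
      Submodule.smul_mem _ _ (mon_mem (by omega) (by omega))
    have h4 := Submodule.add_mem _ (Sp_mono (lo' := l1 + l2 - 2 * q) (hi' := h1 + h2) (by omega) (by omega) hu) h3
    rw [sub_add_cancel] at h4
    exact h4
  exact this (Submodule.mul_mem_mul hφ hψ)

lemma Lead.mul (hq : 2 ≤ q) (ha : a ≠ 0) {l1 h1 l2 h2 : ℤ} {φ ψ : Pt q a b e → K}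
    (hl1 : l1 ≤ h1) (hl2 : l2 ≤ h2)
    (hφ : Lead q a b e l1 h1 φ) (hψ : Lead q a b e l2 h2 ψ) :
    Lead q a b e (l1 + l2 - 2 * q) (h1 + h2) (φ * ψ) := by
  obtain ⟨u, hu, hφ⟩ := hφ
  obtain ⟨u', hu', hψ⟩ := hψ
  obtain ⟨u'', hu'', hm⟩ := mon_mul (b := b) (e := e) hq ha h1 h2
  refine ⟨u * u' * u'', by positivity, ?_⟩
  have hm1 : mon q a b e h1 ∈ Sp q a b e l1 h1 := mon_mem hl1 le_rfl
  have hm2 : mon q a b e h2 ∈ Sp q a b e l2 h2 := mon_mem hl2 le_rfl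
  have t1 := Sp_mono (lo' := l1 + l2 - 2 * q) (hi' := h1 + h2 - 1) (by omega) (by omega) hm
  have t2 := Sp_mono (lo' := l1 + l2 - 2 * q) (hi' := h1 + h2 - 1) (by omega) (by omega) (Sp_mul hq ha hm1 hψ)
  have t3 := Sp_mono (lo' := l1 + l2 - 2 * q) (hi' := h1 + h2 - 1) (by omega) (by omega) (Sp_mul hq ha hφ hm2)
  have t4 := Sp_mono (lo' := l1 + l2 - 2 * q) (hi' := h1 + h2 - 1) (by omega) (by omega) (Sp_mul hq ha hφ hψ)
  have := Submodule.add_mem _ (Submodule.add_mem _ (Submodule.smul_mem _ (u * u') t1) (Submodule.smul_mem _ u t2))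
    (Submodule.add_mem _ (Submodule.smul_mem _ u' t3) t4)
  convert this using 1
  funext t
  simp only [Pi.mul_apply, Pi.sub_apply, Pi.smul_apply, smul_eq_mul, Pi.add_apply]
  ring

lemma Lead.mon (v : ℤ) : Lead q a b e v v (mon q a b e v) :=
  ⟨1, one_ne_zero, by simp⟩

lemma mon_zero : mon q a b e 0 = 1 := by
  funext t; simp [KL.mon]

lemma Lead.mon_pow (hq : 2 ≤ q) (ha : a ≠ 0) (v : ℤ) (n : ℕ) :
    Lead q a b e (n * v - 2 * q * n) (n * v) (KL.mon q a b e v ^ n) := by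
  induction n with
  | zero => have := Lead.mon (q := q) (a := a) (b := b) (e := e) 0; rw [mon_zero] at this; simpa using this
  | succ n ih =>
    have hqn : (0 : ℤ) ≤ 2 * q * n := by positivity
    have := Lead.mul hq ha (by omega) le_rfl ih (Lead.mon v)
    rw [pow_succ]
    convert this using 1 <;> push_cast <;> ring

lemma Lead.mon_mul_pow (hq : 2 ≤ q) (ha : a ≠ 0) (u v : ℤ) (n : ℕ) :
    Lead q a b e (u + n * v - 2 * q * n - 2 * q) (u + n * v) (KL.mon q a b e u * KL.mon q a b e v ^ n) := by
  have hqn : (0 : ℤ) ≤ 2 * q * n := by positivity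
  have := Lead.mul hq ha le_rfl (by omega) (Lead.mon u) (Lead.mon_pow (b := b) (e := e) hq ha v n)
  convert this using 1 ; ring

lemma Lead.mem {lo hi : ℤ} {φ : Pt q a b e → K} (h : lo ≤ hi) (hφ : Lead q a b e lo hi φ) :
    φ ∈ Sp q a b e lo hi := by
  obtain ⟨u, -, hφ⟩ := hφ
  have := Submodule.add_mem _ (Sp_mono (lo' := lo) (hi' := hi) le_rfl (by omega) hφ)
    (Submodule.smul_mem _ u (mon_mem h le_rfl))
  simpa using this

lemma final_count (hq : 2 ≤ q) (T : Finset K)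
    (hT : ∀ x ∈ T, x ≠ 0 ∧ ∃ Z : Finset K, Z.card = q ∧ ∀ z ∈ Z, z ^ q = z + a * x + b * x⁻¹ - e)
    (lo w : ℤ) (hlo : lo ≤ w)
    (h : mon q a b e w ∈ Sp q a b e lo (w - 1)) : (q : ℤ) * T.card ≤ w - lo + q := by
  classical
  have hq0 : 0 < q := by omega
  have hqz : (0 : ℤ) < q := by exact_mod_cast hq0
  obtain ⟨I, j, hj, hw⟩ := exists_rep hq0 w
  set i0 := lo / q with hi0
  have key : ∀ φ ∈ Sp q a b e lo (w - 1), ∃ f : ℕ → Polynomial K,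
      (f j).degree < ((I - i0).toNat : ℕ) ∧
      ∀ t : Pt q a b e, φ t * t.1.1 ^ (-i0) = ∑ s ∈ Finset.range q, (f s).eval t.1.1 * t.1.2 ^ s := by
    intro φ hφ
    refine Submodule.span_induction (p := fun φ _ => ∃ f : ℕ → Polynomial K,
      (f j).degree < ((I - i0).toNat : ℕ) ∧
      ∀ t : Pt q a b e, φ t * t.1.1 ^ (-i0) = ∑ s ∈ Finset.range q, (f s).eval t.1.1 * t.1.2 ^ s) ?_ ?_ ?_ ?_ hφ
    · rintro _ ⟨v, ⟨hv1, hv2⟩, rfl⟩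
      obtain ⟨i, s, hs, rfl⟩ := exists_rep hq0 v
      have hii : i0 ≤ i := by
        have h1 : lo / q ≤ (q * i + s) / q := Int.ediv_le_ediv hqz hv1
        have h2 : ((q : ℤ) * i + s) / q = i := by
          rw [add_comm, Int.add_mul_ediv_left _ _ hqz.ne', Int.ediv_eq_zero_of_lt (by positivity) (by exact_mod_cast hs)]
          simp
        omega
      refine ⟨fun s' => if s' = s then Polynomial.X ^ (i - i0).toNat else 0, ?_, ?_⟩
      · by_cases hjs : j = s
        · subst hjs
          have : i < I := by
            by_contra hcon
            push Not at hcon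
            have := mul_le_mul_of_nonneg_left hcon hqz.le
            omega
          simp only [if_true, Polynomial.degree_X_pow]
          exact_mod_cast (by omega : (i - i0).toNat < (I - i0).toNat)
        · simp [hjs]
      · intro t
        have hx := t.2.1
        rw [mon_eq hq0 _ _ hs]
        rw [Finset.sum_eq_single s]
        · simp only [if_true, Polynomial.eval_pow, Polynomial.eval_X]
          have : t.1.1 ^ (i - i0).toNat = t.1.1 ^ (i - i0) := by
            rw [← zpow_natCast, Int.toNat_of_nonneg (by omega)]
          rw [this, sub_eq_add_neg, zpow_add₀ hx]; ring
        · intro s' _ hs'; simp [hs']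
        · intro hcon; simp [hs] at hcon
    · exact ⟨fun _ => 0, by simp, by simp⟩
    · rintro φ ψ - - ⟨f, hf1, hf2⟩ ⟨g, hg1, hg2⟩
      refine ⟨fun s => f s + g s, lt_of_le_of_lt (Polynomial.degree_add_le _ _) (max_lt hf1 hg1), ?_⟩
      intro t
      simp only [Pi.add_apply, Polynomial.eval_add, add_mul, Finset.sum_add_distrib, hf2, hg2]
    · rintro c φ - ⟨f, hf1, hf2⟩
      refine ⟨fun s => Polynomial.C c * f s, lt_of_le_of_lt ?_ hf1, ?_⟩
      · calc _ ≤ (Polynomial.C c).degree + (f j).degree := Polynomial.degree_mul_le _ _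
          _ ≤ 0 + (f j).degree := by gcongr; exact Polynomial.degree_C_le
          _ = _ := zero_add _
      · intro t
        simp only [Pi.smul_apply, smul_eq_mul, Polynomial.eval_mul, Polynomial.eval_C, mul_assoc, hf2, Finset.mul_sum]
  obtain ⟨f, hf1, hf2⟩ := key _ h
  have hI0 : i0 ≤ I := by
    have h1 : lo / q ≤ w / q := Int.ediv_le_ediv hqz hlo
    have h2 : w / q = I := by
      rw [hw, add_comm, Int.add_mul_ediv_left _ _ hqz.ne', Int.ediv_eq_zero_of_lt (by positivity) (by exact_mod_cast hj)]
      simp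
    omega
  set D := (I - i0).toNat with hD
  set R : Polynomial K := Polynomial.X ^ D - f j with hR
  have hRdeg : R.degree = D := by
    rw [hR, Polynomial.degree_sub_eq_left_of_degree_lt, Polynomial.degree_X_pow]
    rw [Polynomial.degree_X_pow]; exact hf1
  have hR0 : R ≠ 0 := by
    intro h0; rw [h0] at hRdeg; simp at hRdeg
  have hroot : ∀ x ∈ T, R.eval x = 0 := by
    intro x hx
    obtain ⟨hx0, Z, hZ, hZ2⟩ := hT x hx
    set V : Polynomial K := ∑ s ∈ Finset.range q,
      Polynomial.C ((f s).eval x - if s = j then x ^ D else 0) * Polynomial.X ^ s with hV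
    have hVdeg : V.degree < q := by
      refine lt_of_le_of_lt (Polynomial.degree_sum_le _ _) ?_
      rw [Finset.sup_lt_iff (by exact WithBot.bot_lt_coe q)]
      intro s hs
      refine lt_of_le_of_lt (Polynomial.degree_C_mul_X_pow_le _ _) ?_
      exact_mod_cast Finset.mem_range.1 hs
    have hV0 : V = 0 := by
      refine Polynomial.eq_zero_of_degree_lt_of_eval_finset_eq_zero Z (by rw [hZ]; exact hVdeg) ?_
      intro z hz
      have := hf2 ⟨(x, z), hx0, hZ2 z hz⟩
      rw [hw, mon_eq hq0 _ _ hj] at this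
      simp only at this
      rw [hV, Polynomial.eval_finsetSum]
      simp only [Polynomial.eval_mul, Polynomial.eval_C, Polynomial.eval_pow, Polynomial.eval_X, sub_mul,
        Finset.sum_sub_distrib, ← this, ite_mul, zero_mul]
      rw [Finset.sum_ite_eq', if_pos (Finset.mem_range.2 hj)]
      have h3 : x ^ D = x ^ (I - i0) := by
        rw [← zpow_natCast, hD, Int.toNat_of_nonneg (by omega)]
      rw [h3, sub_eq_add_neg I, zpow_add₀ hx0]; ring
    have hc : V.coeff j = (f j).eval x - x ^ D := by
      rw [hV, Polynomial.finsetSum_coeff]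
      simp only [Polynomial.coeff_C_mul, Polynomial.coeff_X_pow]
      rw [Finset.sum_eq_single j]
      · simp
      · intro s _ hs; simp [Ne.symm hs]
      · intro hcon; simp [hj] at hcon
    rw [hV0, Polynomial.coeff_zero] at hc
    rw [hR]; simp only [Polynomial.eval_sub, Polynomial.eval_pow, Polynomial.eval_X]
    linear_combination hc
  have hcard : T.card ≤ D := by
    by_contra hcon
    push Not at hcon
    apply hR0
    refine Polynomial.eq_zero_of_degree_lt_of_eval_finset_eq_zero T ?_ hroot
    rw [hRdeg]; exact_mod_cast hcon
  have h1 : (T.card : ℤ) ≤ I - i0 := by omega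
  have h2 := mul_le_mul_of_nonneg_left h1 hqz.le
  have h3 : lo ≤ q * i0 + q := by
    have h5 := Int.mul_ediv_add_emod lo q
    have h6 := Int.emod_lt_of_pos lo hqz
    rw [← hi0] at h5
    omega
  have h4 : (0 : ℤ) ≤ j := by positivity
  nlinarith

theorem stepanov [Fintype K] (p s : ℕ) [Fact p.Prime] [CharP K p] (P : ℕ) (hP : P = p ^ s)
    (hcard : Fintype.card K = P ^ 2) (hq : 2 ≤ q) (hPq : 4 * q + 1 < P) (ha : a ≠ 0) (T : Finset K)
    (hT : ∀ x ∈ T, x ≠ 0 ∧ ∃ Z : Finset K, Z.card = q ∧ ∀ z ∈ Z, z ^ q = z + a * x + b * x⁻¹ - e) :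
    q * T.card ≤ P ^ 2 + 9 * q * P := by
  classical
  have hq0 : 0 < q := by omega
  set l : ℕ := P + 2 * q with hl
  set lo : ℤ := -(2 * q * P) - 2 * q with hlo
  set hi : ℤ := (P - 1) * P + l with hhi
  have hPz : (4 * q + 1 : ℤ) < P := by exact_mod_cast hPq
  have hqz : (2 : ℤ) ≤ q := by exact_mod_cast hq
  have hqP : (0 : ℤ) ≤ q * P := by positivity
  -- the family
  let φ : Fin P × Fin (l + 1) → Sp q a b e lo hi := fun uv =>
    ⟨mon q a b e (uv.2 : ℕ) * mon q a b e (uv.1 : ℕ) ^ P, by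
      refine Sp_mono ?_ ?_ (Lead.mem ?_ (Lead.mon_mul_pow (b := b) (e := e) hq ha (uv.2 : ℕ) (uv.1 : ℕ) P))
      · have : (0 : ℤ) ≤ (uv.2 : ℕ) + P * (uv.1 : ℕ) := by positivity
        nlinarith
      · have h1 : ((uv.1 : ℕ) : ℤ) ≤ P - 1 := by have := uv.1.2; omega
        have h2 : ((uv.2 : ℕ) : ℤ) ≤ l := by have := uv.2.2; omega
        nlinarith
      · nlinarith⟩
  have hfin : Module.finrank K (Sp q a b e lo hi) ≤ (hi + 1 - lo).toNat := by
    unfold Sp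
    have hS : (mon q a b e '' Set.Icc lo hi) = ((Finset.Icc lo hi).image (mon q a b e) : Finset _) := by
      simp
    rw [hS]
    refine (finrank_span_finset_le_card _).trans (Finset.card_image_le.trans ?_)
    rw [Int.card_Icc]
  have : FiniteDimensional K (Sp q a b e lo hi) := by
    unfold Sp
    exact FiniteDimensional.span_of_finite K ((Set.finite_Icc lo hi).image _)
  have hnot : ¬ LinearIndependent K φ := by
    intro hli
    have h1 := hli.fintype_card_le_finrank
    rw [Fintype.card_prod, Fintype.card_fin, Fintype.card_fin] at h1
    have h2 := h1.trans hfin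
    have h3 : ((P * (l + 1) : ℕ) : ℤ) ≤ ((hi + 1 - lo).toNat : ℕ) := by exact_mod_cast h2
    rw [Int.toNat_of_nonneg (by rw [hhi, hlo]; nlinarith)] at h3
    rw [hhi, hlo, hl] at h3
    push_cast at h3
    nlinarith
  rw [Fintype.not_linearIndependent_iff] at hnot
  obtain ⟨γ, hγ, i1, hi1⟩ := hnot
  have hγ' : ∑ uv, γ uv • (mon q a b e (uv.2 : ℕ) * mon q a b e (uv.1 : ℕ) ^ P) = 0 := by
    have := congrArg (Subtype.val) hγ
    simpa [φ] using this
  have hfrob : ∀ y : K, (y ^ P) ^ P = y := by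
    intro y; rw [← pow_mul, ← sq, ← hcard, FiniteField.pow_card]
  -- the auxiliary function
  have hB : ∑ uv, γ uv ^ P • (mon q a b e (uv.1 : ℕ) * mon q a b e (uv.2 : ℕ) ^ P) = 0 := by
    funext t
    have hpow : ((∑ uv, γ uv ^ P • (mon q a b e (uv.1 : ℕ) * mon q a b e (uv.2 : ℕ) ^ P)) t) ^ P = 0 := by
      have h1 := congrFun hγ' t
      simp only [Finset.sum_apply, Pi.smul_apply, Pi.mul_apply, Pi.pow_apply, smul_eq_mul, Pi.zero_apply] at h1 ⊢
      have hsum : ∀ f : Fin P × Fin (l + 1) → K, (∑ i, f i) ^ P = ∑ i, f i ^ P := by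
        intro f
        have := sum_pow_char_pow p s Finset.univ f
        rw [← hP] at this; exact this
      rw [hsum, ← h1]
      refine Finset.sum_congr rfl fun uv _ => ?_
      rw [mul_pow, mul_pow, hfrob, hfrob]; ring
    exact pow_eq_zero_iff (by omega) |>.1 hpow
  -- leading term
  let wt : Fin P × Fin (l + 1) → ℤ := fun uv => (uv.1 : ℕ) + P * (uv.2 : ℕ)
  have hwt : Function.Injective wt := by
    intro x y hxy
    have h0 : (x.1 : ℕ) + P * (x.2 : ℕ) = (y.1 : ℕ) + P * (y.2 : ℕ) := by
      have : ((x.1 : ℕ) : ℤ) + P * (x.2 : ℕ) = (y.1 : ℕ) + P * (y.2 : ℕ) := hxy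
      exact_mod_cast this
    have h1 := congrArg (· % P) h0
    simp only [Nat.add_mul_mod_self_left, Nat.mod_eq_of_lt x.1.2, Nat.mod_eq_of_lt y.1.2] at h1
    have h2 : (x.2 : ℕ) = y.2 := by
      rw [h1] at h0
      exact Nat.eq_of_mul_eq_mul_left (by omega) (by omega : P * (x.2 : ℕ) = P * y.2)
    exact Prod.ext (Fin.ext h1) (Fin.ext h2)
  obtain ⟨top, htop, hmax⟩ := Finset.exists_max_image (Finset.univ.filter fun uv => γ uv ≠ 0) wt ⟨i1, by simp [hi1]⟩
  have htop' : γ top ≠ 0 := by simpa using htop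
  have hwt0 : 0 ≤ wt top := by simp only [wt]; positivity
  have hrest : ∀ uv, uv ≠ top → γ uv ^ P • (mon q a b e (uv.1 : ℕ) * mon q a b e (uv.2 : ℕ) ^ P) ∈
      Sp q a b e lo (wt top - 1) := by
    intro uv huv
    by_cases h0 : γ uv = 0
    · rw [h0, zero_pow (by omega), zero_smul]; exact Submodule.zero_mem _
    · have h1 := hmax uv (by simp [h0])
      have h2 : wt uv ≠ wt top := fun h => huv (hwt h)
      have h3 : wt uv < wt top := lt_of_le_of_ne h1 h2
      have h4 : (0 : ℤ) ≤ wt uv := by simp only [wt]; positivity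
      refine Submodule.smul_mem _ _ (Sp_mono ?_ ?_ (Lead.mem ?_ (Lead.mon_mul_pow (b := b) (e := e) hq ha (uv.1 : ℕ) (uv.2 : ℕ) P)))
      · change lo ≤ wt uv - _ - _
        nlinarith
      · change wt uv ≤ _
        omega
      · nlinarith
  have hmem : mon q a b e (wt top) ∈ Sp q a b e lo (wt top - 1) := by
    rw [← Finset.add_sum_erase _ _ (Finset.mem_univ top)] at hB
    obtain ⟨u, hu, hLu⟩ := Lead.mon_mul_pow (b := b) (e := e) hq ha (top.1 : ℕ) (top.2 : ℕ) P
    have hLu' := Sp_mono (lo' := lo) (hi' := wt top - 1) (by change lo ≤ wt top - _ - _; nlinarith) le_rfl hLu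
    have hs : ∑ uv ∈ Finset.univ.erase top, γ uv ^ P • (mon q a b e (uv.1 : ℕ) * mon q a b e (uv.2 : ℕ) ^ P)
        ∈ Sp q a b e lo (wt top - 1) :=
      Submodule.sum_mem _ fun uv huv => hrest uv (Finset.ne_of_mem_erase huv)
    have h5 := Submodule.add_mem _ hs (Submodule.smul_mem _ (γ top ^ P) hLu')
    have h6 : ∑ uv ∈ Finset.univ.erase top, γ uv ^ P • (mon q a b e (uv.1 : ℕ) * mon q a b e (uv.2 : ℕ) ^ P)
        + γ top ^ P • (mon q a b e (top.1 : ℕ) * mon q a b e (top.2 : ℕ) ^ P - u • mon q a b e ((top.1 : ℕ) + P * (top.2 : ℕ)))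
        = (-(γ top ^ P * u)) • mon q a b e (wt top) := by
      rw [smul_sub, smul_smul, neg_smul]
      change _ = -((γ top ^ P * u) • mon q a b e ((top.1 : ℕ) + P * (top.2 : ℕ)))
      rw [← sub_eq_zero, ← hB]
      abel
    rw [h6] at h5
    exact (Submodule.smul_mem_iff _ (neg_ne_zero.2 (mul_ne_zero (pow_ne_zero _ htop') hu))).1 h5
  have hfc := final_count hq T hT lo (wt top) (by nlinarith) hmem
  have hw2 : wt top ≤ P - 1 + P * l := by
    have h1 : ((top.1 : ℕ) : ℤ) ≤ P - 1 := by have := top.1.2; omega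
    have h2 : ((top.2 : ℕ) : ℤ) ≤ l := by have := top.2.2; omega
    simp only [wt]
    nlinarith
  have hfinal : (q : ℤ) * T.card ≤ P ^ 2 + 9 * q * P := by
    rw [hlo] at hfc
    rw [hl] at hw2
    push_cast at hw2
    nlinarith
  exact_mod_cast hfinal

end stepanov
end KL

namespace KL
section ext
variable {F K : Type} [Field F] [Fintype F] [Field K] [Fintype K] [Algebra F K]

lemma artin_schreier (y : K) (hy : Algebra.trace F K y = 0) :
    ∃ Z : Finset K, Z.card = Fintype.card F ∧ ∀ z ∈ Z, z ^ Fintype.card F = z + y := by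
  classical
  set q := Fintype.card F with hq
  have hq1 : 1 < q := Fintype.one_lt_card
  let L : K →ₗ[F] K := (FiniteField.frobeniusAlgHom F K).toLinearMap - LinearMap.id
  have hL : ∀ z, L z = z ^ q - z := fun z => by simp [L, hq]
  have hle : LinearMap.range L ≤ LinearMap.ker (Algebra.trace F K) := by
    rintro _ ⟨z, rfl⟩
    rw [LinearMap.mem_ker]
    have h1 : L z = FiniteField.frobeniusAlgEquivOfAlgebraic F K z - z := by
      rw [hL]; simp [hq]
    rw [h1, map_sub, Algebra.trace_eq_of_algEquiv, sub_self]
  have hker : Module.finrank F (LinearMap.ker L) ≤ 1 := by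
    have h1 : Nat.card (LinearMap.ker L) ≤ q := by
      let pol : Polynomial K := Polynomial.X ^ q - Polynomial.X
      have hpol : pol ≠ 0 := FiniteField.X_pow_card_sub_X_ne_zero K hq1
      have hdeg : pol.natDegree = q := FiniteField.X_pow_card_sub_X_natDegree_eq K hq1
      have h2 : ∀ z : LinearMap.ker L, (z : K) ∈ pol.roots.toFinset := by
        intro z
        have := z.2
        rw [LinearMap.mem_ker, hL] at this
        simp only [Multiset.mem_toFinset, Polynomial.mem_roots hpol, Polynomial.IsRoot.def, pol]
        simpa using this
      calc Nat.card (LinearMap.ker L) = Fintype.card (LinearMap.ker L) := Nat.card_eq_fintype_card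
        _ ≤ Fintype.card pol.roots.toFinset := Fintype.card_le_of_injective (fun z => (⟨z, h2 z⟩ : pol.roots.toFinset))
            (by intro x y hxy; simpa using hxy)
        _ = pol.roots.toFinset.card := Fintype.card_coe _
        _ ≤ pol.roots.card := Multiset.toFinset_card_le _
        _ ≤ pol.natDegree := Polynomial.card_roots' _
        _ = q := hdeg
    rw [Module.natCard_eq_pow_finrank (K := F), Nat.card_eq_fintype_card, ← hq] at h1
    by_contra hcon
    push Not at hcon
    have : q ^ 2 ≤ q ^ Module.finrank F (LinearMap.ker L) := Nat.pow_le_pow_right (by omega) hcon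
    nlinarith
  have htr : Module.finrank F (LinearMap.range (Algebra.trace F K)) = 1 := by
    rw [LinearMap.range_eq_top.2 (Algebra.trace_surjective F K)]; simp
  have e1 := LinearMap.finrank_range_add_finrank_ker L
  have e2 := LinearMap.finrank_range_add_finrank_ker (Algebra.trace F K)
  have heq : LinearMap.range L = LinearMap.ker (Algebra.trace F K) :=
    Submodule.eq_of_le_of_finrank_le hle (by omega)
  have hmem : y ∈ LinearMap.range L := by rw [heq]; exact hy
  obtain ⟨z0, hz0⟩ := hmem
  rw [hL] at hz0
  refine ⟨Finset.univ.image (fun c : F => z0 + algebraMap F K c), ?_, ?_⟩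
  · rw [Finset.card_image_of_injective, Finset.card_univ]
    intro c c' h
    exact (algebraMap F K).injective (by simpa using h)
  · intro z hz
    obtain ⟨c, -, rfl⟩ := Finset.mem_image.1 hz
    have h1 : (z0 + algebraMap F K c) ^ q = z0 ^ q + algebraMap F K c := by
      have := map_add (FiniteField.frobeniusAlgHom F K) z0 (algebraMap F K c)
      simpa [hq] using this
    rw [h1]
    linear_combination hz0

lemma level_count (m : ℕ) (hm : 3 ≤ m) (hK : Fintype.card K = Fintype.card F ^ (2 * m))
    (hF : 3 ≤ Fintype.card F) (a b c : F) (ha : a ≠ 0) [DecidableEq F] [DecidableEq K] :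
    Fintype.card F * (Finset.univ.filter fun x : K => x ≠ 0 ∧
      Algebra.trace F K (algebraMap F K a * x + algebraMap F K b * x⁻¹) = c).card
      ≤ (Fintype.card F ^ m) ^ 2 + 9 * Fintype.card F * Fintype.card F ^ m := by
  obtain ⟨p, hp⟩ := CharP.exists F
  have : Fact p.Prime := ⟨CharP.char_is_prime F p⟩
  have : CharP K p := charP_of_injective_algebraMap (algebraMap F K).injective p
  obtain ⟨r, -, hr⟩ := FiniteField.card F p
  obtain ⟨e, he⟩ := Algebra.trace_surjective F K c
  refine stepanov (a := algebraMap F K a) (b := algebraMap F K b) (e := e) p (r * m) _ ?_ ?_ ?_ ?_ ?_ _ ?_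
  · rw [hr, pow_mul]
  · rw [hK, ← pow_mul, mul_comm]
  · omega
  · set q := Fintype.card F
    calc 4 * q + 1 < q ^ 3 := by nlinarith [sq_nonneg ((q:ℤ) - 3), Nat.mul_le_mul hF hF]
      _ ≤ q ^ m := Nat.pow_le_pow_right (by omega) hm
  · simpa using ha
  · intro x hx
    simp only [Finset.mem_filter, Finset.mem_univ, true_and] at hx
    refine ⟨hx.1, ?_⟩
    obtain ⟨Z, hZ, hZ2⟩ := artin_schreier (F := F) (algebraMap F K a * x + algebraMap F K b * x⁻¹ - e)
      (by rw [map_sub, hx.2, he, sub_self])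
    exact ⟨Z, hZ, fun z hz => by rw [hZ2 z hz]; ring⟩

lemma kloos_ext_bound (m : ℕ) (hm : 3 ≤ m) (hK : Fintype.card K = Fintype.card F ^ (2 * m))
    (hF : 3 ≤ Fintype.card F) (a b : F) (ha : a ≠ 0) [DecidableEq F] [DecidableEq K]
    (ψ : AddChar F ℂ) (hψ : ψ ≠ 1) :
    ‖∑ x ∈ Finset.univ.filter (fun x : K => x ≠ 0),
      ψ (Algebra.trace F K (algebraMap F K a * x + algebraMap F K b * x⁻¹))‖
      ≤ 19 * Fintype.card F * (Fintype.card F : ℝ) ^ m := by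
  set q := Fintype.card F with hq
  set g : K → F := fun x => Algebra.trace F K (algebraMap F K a * x + algebraMap F K b * x⁻¹) with hg
  set N : F → ℝ := fun c => ((Finset.univ.filter fun x : K => x ≠ 0 ∧ g x = c).card : ℝ) with hN
  set P : ℝ := (q : ℝ) ^ m with hP
  have hq3 : (3 : ℝ) ≤ q := by exact_mod_cast hF
  have hP1 : (1 : ℝ) ≤ P := one_le_pow₀ (by linarith)
  have hNle : ∀ c, N c - P ^ 2 / q ≤ 9 * P := by
    intro c
    have h := level_count (K := K) m hm hK hF a b c ha
    have h' : (q : ℝ) * N c ≤ P ^ 2 + 9 * q * P := by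
      have h2 := (Nat.cast_le (α := ℝ)).2 h
      push_cast at h2
      exact h2
    rw [sub_le_iff_le_add]
    have : N c ≤ (P ^ 2 + 9 * q * P) / q := by
      rw [le_div_iff₀ (by linarith)]; linarith
    calc N c ≤ _ := this
      _ = _ := by field_simp; ring
  have hNsum : ∑ c, N c = P ^ 2 - 1 := by
    have h1 := Finset.card_eq_sum_card_fiberwise (s := Finset.univ.filter fun x : K => x ≠ 0) (t := Finset.univ) (f := g)
      (by intro x _; simp)
    simp only [Finset.filter_filter] at h1
    have h2 : (Finset.univ.filter fun x : K => x ≠ 0).card = Fintype.card K - 1 := by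
      rw [Finset.filter_ne' Finset.univ (0 : K), Finset.card_erase_of_mem (Finset.mem_univ _), Finset.card_univ]
    have h3 : (((Finset.univ.filter fun x : K => x ≠ 0).card : ℕ) : ℝ) = P ^ 2 - 1 := by
      rw [h2, Nat.cast_sub Fintype.card_pos, hK, hP, ← pow_mul]; push_cast; rw [mul_comm]
    rw [← h3, h1]; push_cast; rfl
  have hsum : ∑ x ∈ Finset.univ.filter (fun x : K => x ≠ 0), ψ (g x) = ∑ c, ψ c * ((N c - P ^ 2 / q : ℝ) : ℂ) := by
    have h1 : ∑ x ∈ Finset.univ.filter (fun x : K => x ≠ 0), ψ (g x) = ∑ c, ψ c * (N c : ℂ) := by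
      rw [← Finset.sum_fiberwise_of_maps_to (t := Finset.univ) (g := g) (by intro x _; simp)]
      refine Finset.sum_congr rfl fun c _ => ?_
      rw [Finset.filter_filter, Finset.sum_congr rfl (g := fun _ => ψ c)]
      · simp [hN, mul_comm]
      · intro x hx; simp only [Finset.mem_filter] at hx; rw [hx.2.2]
    rw [h1]
    push_cast
    simp only [mul_sub, Finset.sum_sub_distrib, ← Finset.sum_mul]
    rw [AddChar.sum_eq_zero_of_ne_one hψ]; simp
  rw [hsum]
  calc ‖∑ c, ψ c * ((N c - P ^ 2 / q : ℝ) : ℂ)‖ ≤ ∑ c, ‖ψ c * ((N c - P ^ 2 / q : ℝ) : ℂ)‖ := norm_sum_le _ _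
    _ = ∑ c, |N c - P ^ 2 / q| := by
        refine Finset.sum_congr rfl fun c _ => ?_
        rw [norm_mul, AddChar.norm_apply, one_mul, Complex.norm_real, Real.norm_eq_abs]
    _ ≤ ∑ c : F, (2 * (9 * P) - (N c - P ^ 2 / q)) := by
        refine Finset.sum_le_sum fun c _ => ?_
        have := hNle c
        rw [abs_le]; constructor <;> linarith
    _ = 18 * q * P + 1 := by
        rw [Finset.sum_sub_distrib, Finset.sum_sub_distrib, hNsum]
        simp only [Finset.sum_const, Finset.card_univ, ← hq, nsmul_eq_mul]
        field_simp; ring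
    _ ≤ 19 * q * P := by nlinarith
end ext
section lfun
open Polynomial
open scoped Classical
variable {F : Type} [Field F] [Fintype F]

lemma finite_natDegree_le (n : ℕ) : {f : F[X] | f.natDegree ≤ n}.Finite := by
  have h : {f : F[X] | f.natDegree ≤ n} ⊆ Set.range
      (fun c : Fin (n + 1) → F => ∑ i : Fin (n + 1), C (c i) * X ^ (i : ℕ)) := by
    intro f hf
    refine ⟨fun i => f.coeff i, ?_⟩
    have := f.as_sum_range' (n + 1) (Nat.lt_succ_of_le hf)
    simp only
    rw [Fin.sum_univ_eq_sum_range (fun i => C (f.coeff i) * X ^ i) (n + 1)]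
    conv_rhs => rw [this]
    simp [C_mul_X_pow_eq_monomial]
  exact (Set.finite_range _).subset h

noncomputable def U (F : Type) [Field F] [Fintype F] (n : ℕ) : Finset F[X] :=
  (finite_natDegree_le (F := F) n).toFinset

noncomputable def Mo (F : Type) [Field F] [Fintype F] (n : ℕ) : Finset F[X] :=
  (U F n).filter fun f => f.Monic ∧ f.natDegree = n

noncomputable def Ir (F : Type) [Field F] [Fintype F] (n : ℕ) : Finset F[X] :=
  (U F n).filter fun f => f.Monic ∧ Irreducible f ∧ f.natDegree = n

lemma mem_U {n : ℕ} {f : F[X]} : f ∈ U F n ↔ f.natDegree ≤ n := by simp [U]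
lemma mem_Mo {n : ℕ} {f : F[X]} : f ∈ Mo F n ↔ f.Monic ∧ f.natDegree = n := by
  simp only [Mo, Finset.mem_filter, mem_U]
  constructor
  · exact fun h => h.2
  · exact fun h => ⟨h.2.le, h⟩
lemma mem_Ir {n : ℕ} {f : F[X]} : f ∈ Ir F n ↔ f.Monic ∧ Irreducible f ∧ f.natDegree = n := by
  simp only [Ir, Finset.mem_filter, mem_U]
  constructor
  · exact fun h => h.2
  · exact fun h => ⟨h.2.2.le, h⟩

/-- sum over irreducibles grouped by degree -/
lemma sum_irr_group (n : ℕ) (g : F[X] → ℂ) :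
    ∑ π ∈ (U F n).filter (fun f => f.Monic ∧ Irreducible f), g π = ∑ d ∈ Finset.Icc 1 n, ∑ π ∈ Ir F d, g π := by
  rw [← Finset.sum_fiberwise_of_maps_to (t := Finset.Icc 1 n) (g := natDegree)]
  · refine Finset.sum_congr rfl fun d hd => Finset.sum_congr ?_ fun _ _ => rfl
    ext f
    simp only [Finset.mem_filter, mem_U, mem_Ir]
    rw [Finset.mem_Icc] at hd
    constructor
    · rintro ⟨⟨_, h1, h2⟩, h3⟩; exact ⟨h1, h2, h3⟩
    · rintro ⟨h1, h2, h3⟩; exact ⟨⟨by omega, h1, h2⟩, h3⟩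
  · intro f hf
    simp only [Finset.mem_filter, mem_U] at hf
    rw [Finset.mem_Icc]
    exact ⟨hf.2.2.natDegree_pos, hf.1⟩

lemma degree_expand (n : ℕ) (f : F[X]) (hf : f ∈ Mo F n) :
    (n : ℂ) = ∑ d ∈ Finset.Icc 1 n, ∑ π ∈ Ir F d, ∑ k ∈ Finset.Icc 1 n, if π ^ k ∣ f then (d : ℂ) else 0 := by
  rw [mem_Mo] at hf
  obtain ⟨hm, hdeg⟩ := hf
  have hf0 : f ≠ 0 := hm.ne_zero
  have h1 : ∀ d ∈ Finset.Icc 1 n, ∑ π ∈ Ir F d, ∑ k ∈ Finset.Icc 1 n, (if π ^ k ∣ f then (d : ℂ) else 0)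
      = ∑ π ∈ Ir F d, (π.natDegree : ℂ) * ((UniqueFactorizationMonoid.normalizedFactors f).count π : ℂ) := by
    intro d hd
    refine Finset.sum_congr rfl fun π hπ => ?_
    rw [mem_Ir] at hπ
    obtain ⟨hπm, hπi, hπd⟩ := hπ
    set c := (UniqueFactorizationMonoid.normalizedFactors f).count π with hc
    have hdvd : ∀ k, π ^ k ∣ f ↔ k ≤ c := by
      intro k
      rw [pow_dvd_iff_le_emultiplicity, UniqueFactorizationMonoid.emultiplicity_eq_count_normalizedFactors hπi hf0,
        hπm.normalize_eq_self, ← hc]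
      exact Nat.cast_le
    have hcn : c ≤ n := by
      have h2 := (hdvd c).2 le_rfl
      have h3 := natDegree_le_of_dvd h2 hf0
      rw [natDegree_pow, hdeg] at h3
      have := hπi.natDegree_pos
      nlinarith
    simp only [hdvd]
    rw [← Finset.sum_filter, Finset.sum_const]
    have : (Finset.Icc 1 n).filter (fun k => k ≤ c) = Finset.Icc 1 c := by
      ext k; simp only [Finset.mem_filter, Finset.mem_Icc]; omega
    rw [this, Nat.card_Icc, hπd]; simp [mul_comm]
  rw [Finset.sum_congr rfl h1, ← sum_irr_group n (fun π => (π.natDegree : ℂ) * ((UniqueFactorizationMonoid.normalizedFactors f).count π : ℂ))]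
  have h2 : f.natDegree = ((UniqueFactorizationMonoid.normalizedFactors f).map natDegree).sum := by
    have h3 := leadingCoeff_mul_prod_normalizedFactors f
    rw [hm.leadingCoeff, C_1, one_mul] at h3
    conv_lhs => rw [← h3]
    refine natDegree_multiset_prod _ ?_
    exact UniqueFactorizationMonoid.zero_notMem_normalizedFactors f
  rw [Finset.sum_multiset_map_count] at h2
  rw [← hdeg, h2]
  push_cast
  simp only [nsmul_eq_mul]
  push_cast
  refine (Finset.sum_subset ?_ ?_).trans (Finset.sum_congr rfl fun _ _ => mul_comm _ _)
  · intro π hπ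
    rw [Multiset.mem_toFinset, Polynomial.mem_normalizedFactors_iff hf0] at hπ
    simp only [Finset.mem_filter, mem_U]
    exact ⟨(natDegree_le_of_dvd hπ.2.2 hf0).trans h2.le, hπ.2.1, hπ.1⟩
  · intro π _ hπ
    rw [Multiset.mem_toFinset] at hπ
    rw [Multiset.count_eq_zero_of_notMem hπ]; simp

noncomputable def Ls (lam : F[X] → ℂ) (n : ℕ) : ℂ := ∑ f ∈ Mo F n, lam f

noncomputable def Kp (lam : F[X] → ℂ) (j : ℕ) : ℂ :=
  ∑ x ∈ j.divisorsAntidiagonal, ∑ π ∈ Ir F x.1, (x.1 : ℂ) * lam π ^ x.2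

lemma sum_dvd (lam : F[X] → ℂ) (hlam : ∀ f g : F[X], f.Monic → g.Monic → lam (f * g) = lam f * lam g)
    (hone : lam 1 = 1) (n d k : ℕ) (π : F[X]) (hπ : π ∈ Ir F d) :
    ∑ f ∈ Mo F n, (if π ^ k ∣ f then lam f else 0) = if d * k ≤ n then lam π ^ k * Ls lam (n - d * k) else 0 := by
  rw [mem_Ir] at hπ
  obtain ⟨hπm, hπi, hπd⟩ := hπ
  have hpm : (π ^ k).Monic := hπm.pow k
  have hpd : (π ^ k).natDegree = d * k := by rw [natDegree_pow, hπd, mul_comm]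
  have hpow : lam (π ^ k) = lam π ^ k := by
    clear hpm hpd
    induction k with
    | zero => simp [hone]
    | succ k ih => rw [pow_succ, hlam _ _ (hπm.pow k) hπm, ih, pow_succ]
  rw [← Finset.sum_filter]
  split_ifs with h
  · rw [Ls, Finset.mul_sum]
    symm
    refine Finset.sum_bij (fun g _ => π ^ k * g) ?_ ?_ ?_ ?_
    · intro g hg
      rw [mem_Mo] at hg
      rw [Finset.mem_filter, mem_Mo]
      refine ⟨⟨hpm.mul hg.1, ?_⟩, dvd_mul_right _ _⟩
      rw [hpm.natDegree_mul hg.1, hpd, hg.2]; omega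
    · intro g _ g' _ h; exact mul_left_cancel₀ hpm.ne_zero h
    · intro f hf
      rw [Finset.mem_filter, mem_Mo] at hf
      obtain ⟨⟨hfm, hfd⟩, g, rfl⟩ := hf
      have hgm : g.Monic := hpm.of_mul_monic_left hfm
      refine ⟨g, ?_, rfl⟩
      rw [mem_Mo]
      refine ⟨hgm, ?_⟩
      rw [hpm.natDegree_mul hgm, hpd] at hfd; omega
    · intro g hg
      rw [mem_Mo] at hg
      rw [hlam _ _ hpm hg.1, hpow]
  · rw [Finset.filter_false_of_mem, Finset.sum_empty]
    intro f hf hdv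
    rw [mem_Mo] at hf
    have := natDegree_le_of_dvd hdv hf.1.ne_zero
    omega

lemma newton (lam : F[X] → ℂ) (hlam : ∀ f g : F[X], f.Monic → g.Monic → lam (f * g) = lam f * lam g)
    (hone : lam 1 = 1) (n : ℕ) :
    (n : ℂ) * Ls lam n = ∑ j ∈ Finset.Icc 1 n, Kp lam j * Ls lam (n - j) := by
  have h1 : (n : ℂ) * Ls lam n = ∑ d ∈ Finset.Icc 1 n, ∑ k ∈ Finset.Icc 1 n,
      if d * k ≤ n then (∑ π ∈ Ir F d, (d : ℂ) * lam π ^ k) * Ls lam (n - d * k) else 0 := by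
    calc (n : ℂ) * Ls lam n = ∑ f ∈ Mo F n, (n : ℂ) * lam f := by rw [Ls, Finset.mul_sum]
      _ = ∑ f ∈ Mo F n, ∑ d ∈ Finset.Icc 1 n, ∑ π ∈ Ir F d, ∑ k ∈ Finset.Icc 1 n,
            (d : ℂ) * (if π ^ k ∣ f then lam f else 0) := by
          refine Finset.sum_congr rfl fun f hf => ?_
          conv_lhs => rw [degree_expand n f hf]
          simp only [Finset.sum_mul]
          refine Finset.sum_congr rfl fun d _ => Finset.sum_congr rfl fun π _ => Finset.sum_congr rfl fun k _ => ?_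
          split_ifs <;> simp
      _ = ∑ d ∈ Finset.Icc 1 n, ∑ k ∈ Finset.Icc 1 n, ∑ π ∈ Ir F d, ∑ f ∈ Mo F n,
            (d : ℂ) * (if π ^ k ∣ f then lam f else 0) := by
          rw [Finset.sum_comm]
          refine Finset.sum_congr rfl fun d _ => ?_
          rw [Finset.sum_comm]
          rw [Finset.sum_comm (s := Finset.Icc 1 n)]
          refine Finset.sum_congr rfl fun π _ => ?_
          rw [Finset.sum_comm]
      _ = _ := by
          refine Finset.sum_congr rfl fun d _ => Finset.sum_congr rfl fun k _ => ?_
          have : ∀ π ∈ Ir F d, ∑ f ∈ Mo F n, (d : ℂ) * (if π ^ k ∣ f then lam f else 0) =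
              (d : ℂ) * if d * k ≤ n then lam π ^ k * Ls lam (n - d * k) else 0 := by
            intro π hπ
            rw [← Finset.mul_sum, sum_dvd lam hlam hone n d k π hπ]
          rw [Finset.sum_congr rfl this]
          split_ifs
          · rw [Finset.sum_mul]; refine Finset.sum_congr rfl fun _ _ => by ring
          · simp
  rw [h1, ← Finset.sum_product', ← Finset.sum_filter,
    ← Finset.sum_fiberwise_of_maps_to (t := Finset.Icc 1 n) (g := fun x : ℕ × ℕ => x.1 * x.2)]
  · refine Finset.sum_congr rfl fun j hj => ?_
    rw [Kp, Finset.sum_mul]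
    refine Finset.sum_congr ?_ ?_
    · ext ⟨d, k⟩
      simp only [Finset.mem_filter, Finset.mem_product, Finset.mem_Icc, Nat.mem_divisorsAntidiagonal] at hj ⊢
      constructor
      · rintro ⟨_, rfl⟩; exact ⟨rfl, by omega⟩
      · rintro ⟨rfl, h0⟩
        have hd : 0 < d := Nat.pos_of_ne_zero (by rintro rfl; simp at h0)
        have hk : 0 < k := Nat.pos_of_ne_zero (by rintro rfl; simp at h0)
        refine ⟨⟨⟨⟨hd, ?_⟩, hk, ?_⟩, hj.2⟩, rfl⟩ <;> nlinarith
    · intro x hx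
      rw [Nat.mem_divisorsAntidiagonal] at hx
      rw [hx.1]
  · rintro ⟨d, k⟩ hx
    simp only [Finset.mem_filter, Finset.mem_product, Finset.mem_Icc] at hx ⊢
    exact ⟨Nat.mul_pos hx.1.1.1 hx.1.2.1, hx.2⟩

/-- the multiplicative function attached to a Kloosterman sum -/
noncomputable def klam (ψ : AddChar F ℂ) (a b : F) (f : F[X]) : ℂ :=
  if f.coeff 0 = 0 then 0 else ψ (-(a * f.nextCoeff) - b * (f.coeff 1 / f.coeff 0))

lemma klam_mul (ψ : AddChar F ℂ) (a b : F) (f g : F[X]) (hf : f.Monic) (hg : g.Monic) :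
    klam ψ a b (f * g) = klam ψ a b f * klam ψ a b g := by
  unfold klam
  have h0 : (f * g).coeff 0 = f.coeff 0 * g.coeff 0 := mul_coeff_zero f g
  have h1 : (f * g).coeff 1 = f.coeff 0 * g.coeff 1 + f.coeff 1 * g.coeff 0 := by
    rw [mul_coeff_one]
  rw [h0, h1, hf.nextCoeff_mul hg]
  by_cases hf0 : f.coeff 0 = 0
  · simp [hf0]
  by_cases hg0 : g.coeff 0 = 0
  · simp [hg0]
  rw [if_neg (mul_ne_zero hf0 hg0), if_neg hf0, if_neg hg0, ← AddChar.map_add_eq_mul]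
  congr 1
  field_simp
  ring

lemma klam_one (ψ : AddChar F ℂ) (a b : F) : klam ψ a b 1 = 1 := by
  unfold klam
  have : (1 : F[X]).nextCoeff = 0 := nextCoeff_C_eq_zero 1
  rw [this]
  simp [coeff_one]

lemma Ls_zero (ψ : AddChar F ℂ) (a b : F) : Ls (klam ψ a b) 0 = 1 := by
  have : Mo F 0 = {1} := by
    ext f
    rw [mem_Mo, Finset.mem_singleton]
    constructor
    · rintro ⟨h1, h2⟩; exact h1.natDegree_eq_zero.1 h2
    · rintro rfl; simp
  rw [Ls, this, Finset.sum_singleton, klam_one]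

lemma Ls_ge_three (ψ : AddChar F ℂ) (hψ : ψ ≠ 1) (a b : F) (ha : a ≠ 0) (n : ℕ) (hn : 3 ≤ n) :
    Ls (klam ψ a b) n = 0 := by
  obtain ⟨y, hy⟩ := AddChar.ne_one_iff.1 hψ
  set c : F := -(y / a) with hc
  have hdeg : ∀ (f : F[X]) (c : F), f ∈ Mo F n → f + C c * X ^ (n - 1) ∈ Mo F n := by
    intro f c hf
    rw [mem_Mo] at hf ⊢
    have h1 : (C c * X ^ (n - 1)).degree < f.degree := by
      refine lt_of_le_of_lt (degree_C_mul_X_pow_le _ _) ?_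
      rw [degree_eq_natDegree hf.1.ne_zero, hf.2]
      exact_mod_cast (by omega : n - 1 < n)
    exact ⟨hf.1.add_of_left h1, by rw [natDegree_add_eq_left_of_degree_lt h1, hf.2]⟩
  have key : Ls (klam ψ a b) n = ψ y * Ls (klam ψ a b) n := by
    conv_rhs => rw [Ls, Finset.mul_sum]
    rw [Ls]
    symm
    refine Finset.sum_bij (fun f _ => f + C c * X ^ (n - 1)) (fun f hf => hdeg f c hf) ?_ ?_ ?_
    · intro f _ g _ h; exact add_right_cancel h
    · intro f hf
      refine ⟨f + C (-c) * X ^ (n - 1), hdeg f _ hf, ?_⟩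
      rw [C_neg]; ring
    · intro f hf
      have hf' := hdeg f c hf
      rw [mem_Mo] at hf hf'
      unfold klam
      have e0 : (f + C c * X ^ (n - 1)).coeff 0 = f.coeff 0 := by
        rw [coeff_add, coeff_C_mul_X_pow, if_neg (by omega), add_zero]
      have e1 : (f + C c * X ^ (n - 1)).coeff 1 = f.coeff 1 := by
        rw [coeff_add, coeff_C_mul_X_pow, if_neg (by omega), add_zero]
      have e2 : (f + C c * X ^ (n - 1)).nextCoeff = f.nextCoeff + c := by
        rw [nextCoeff_of_natDegree_pos (by omega), nextCoeff_of_natDegree_pos (by omega), hf.2, hf'.2,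
          coeff_add, coeff_C_mul_X_pow, if_pos rfl]
      rw [e0, e1, e2]
      split_ifs
      · simp
      · rw [← AddChar.map_add_eq_mul]
        congr 1
        rw [hc]; field_simp; ring
  have : (1 - ψ y) * Ls (klam ψ a b) n = 0 := by linear_combination key
  rcases mul_eq_zero.1 this with h | h
  · exact absurd (by linear_combination -h) hy
  · exact h

lemma pow_bdd {r C : ℝ} (h : ∀ m : ℕ, 3 ≤ m → r ^ m ≤ C) : r ≤ 1 := by
  by_contra hcon
  push Not at hcon
  obtain ⟨n, hn⟩ := pow_unbounded_of_one_lt C hcon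
  have h1 := h (n + 3) (by omega)
  have h2 : r ^ n ≤ r ^ (n + 3) := pow_le_pow_right₀ hcon.le (by omega)
  linarith

lemma two_pow_bdd {u v : ℂ} {C : ℝ} (h : ∀ m : ℕ, 3 ≤ m → ‖u ^ m + v ^ m‖ ≤ C) : ‖u‖ ≤ 1 := by
  have hC : 0 ≤ C := (norm_nonneg _).trans (h 3 le_rfl)
  have h1 : ‖u * v‖ ≤ 1 := by
    refine pow_bdd (C := (C ^ 2 + C) / 2) fun m hm => ?_
    have e1 : 2 * (u * v) ^ m = (u ^ m + v ^ m) ^ 2 - (u ^ (2 * m) + v ^ (2 * m)) := by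
      rw [mul_pow, two_mul m, pow_add, pow_add]; ring
    have e2 : ‖2 * (u * v) ^ m‖ ≤ C ^ 2 + C := by
      rw [e1]
      refine (norm_sub_le _ _).trans (add_le_add ?_ (h _ (by omega)))
      rw [norm_pow]
      exact pow_le_pow_left₀ (norm_nonneg _) (h m hm) 2
    rw [norm_mul, norm_pow] at e2
    simp at e2
    rw [norm_mul]
    linarith
  by_contra hcon
  push Not at hcon
  rw [norm_mul] at h1
  have hv : ‖v‖ ≤ 1 := by nlinarith [norm_nonneg v]
  refine absurd (pow_bdd (r := ‖u‖) (C := C + 1) fun m hm => ?_) (by linarith)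
  have e3 : ‖u ^ m‖ ≤ ‖u ^ m + v ^ m‖ + ‖v ^ m‖ := by
    have := norm_sub_le (u ^ m + v ^ m) (v ^ m)
    simpa using this
  rw [norm_pow, norm_pow v] at e3
  have := h m hm
  have := pow_le_one₀ (n := m) (norm_nonneg v) hv
  linarith

lemma rec_bound (k : ℕ → ℂ) (L1 L2 : ℂ) (h1 : k 1 = L1) (h2 : 2 * L2 = k 1 * L1 + k 2)
    (h3 : ∀ n, k (n + 3) + k (n + 2) * L1 + k (n + 1) * L2 = 0) (q C : ℝ) (hq : 0 < q)
    (hb : ∀ m, 3 ≤ m → ‖k (2 * m)‖ ≤ C * q ^ m) : ‖L1‖ ≤ 2 * Real.sqrt q := by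
  obtain ⟨s, hs⟩ : ∃ s : ℂ, L1 ^ 2 - 4 * L2 = s ^ 2 := by
    obtain ⟨s, hs⟩ := IsAlgClosed.exists_pow_nat_eq (L1 ^ 2 - 4 * L2) (n := 2) two_pos
    exact ⟨s, hs.symm⟩
  set α := (-L1 + s) / 2 with hα
  set β := (-L1 - s) / 2 with hβ
  have hsum : α + β = -L1 := by rw [hα, hβ]; ring
  have hprod : α * β = L2 := by rw [hα, hβ]; linear_combination hs / 4
  have hk : ∀ n, k (n + 1) = -(α ^ (n + 1) + β ^ (n + 1)) ∧ k (n + 2) = -(α ^ (n + 2) + β ^ (n + 2)) := by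
    intro n
    induction n with
    | zero =>
      constructor
      · simp only [zero_add, pow_one]; rw [h1, hsum, neg_neg]
      · have : k 2 = 2 * L2 - L1 ^ 2 := by rw [h1] at h2; linear_combination -h2
        simp only [zero_add]; rw [this]
        have e : L1 = -(α + β) := by rw [hsum]; ring
        rw [e, ← hprod]; ring
    | succ n ih =>
      refine ⟨ih.2, ?_⟩
      have e : L1 = -(α + β) := by rw [hsum]; ring
      have h := h3 n
      rw [ih.1, ih.2, e, ← hprod] at h
      have : k (n + 1 + 2) = k (n + 3) := rfl
      rw [this]
      linear_combination h
  have hb' : ∀ m : ℕ, 3 ≤ m → ‖(α ^ 2 / q) ^ m + (β ^ 2 / q) ^ m‖ ≤ C := by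
    intro m hm
    have h := hb m hm
    obtain ⟨r, hr⟩ : ∃ r, 2 * m = r + 1 := ⟨2 * m - 1, by omega⟩
    rw [hr, (hk r).1, ← hr, norm_neg, pow_mul, pow_mul] at h
    have e : (α ^ 2 / q) ^ m + (β ^ 2 / q) ^ m = ((α ^ 2) ^ m + (β ^ 2) ^ m) / (q : ℂ) ^ m := by
      rw [div_pow, div_pow]; ring
    rw [e, norm_div, norm_pow, Complex.norm_real, Real.norm_of_nonneg hq.le, div_le_iff₀ (by positivity)]
    exact h
  have hαb := two_pow_bdd hb'
  have hβb := two_pow_bdd (u := β ^ 2 / q) (v := α ^ 2 / q) (C := C) (fun m hm => by rw [add_comm]; exact hb' m hm)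
  have hfin : ∀ w : ℂ, ‖w ^ 2 / q‖ ≤ 1 → ‖w‖ ≤ Real.sqrt q := by
    intro w hw
    rw [norm_div, norm_pow, Complex.norm_real, Real.norm_of_nonneg hq.le, div_le_one hq] at hw
    exact Real.le_sqrt_of_sq_le hw
  have : ‖L1‖ = ‖α + β‖ := by rw [hsum, norm_neg]
  rw [this]
  have := norm_add_le α β
  have := hfin α hαb
  have := hfin β hβb
  linarith
end lfun
section lext
open Polynomial IntermediateField
open scoped Classical
variable {F K : Type} [Field F] [Fintype F] [Field K] [Fintype K] [Algebra F K]

lemma minpoly_inv_nextCoeff (x : K) (hx : x ≠ 0) :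
    (minpoly F x⁻¹).nextCoeff = (minpoly F x).coeff 1 / (minpoly F x).coeff 0 := by
  have hi : IsIntegral F x := IsIntegral.of_finite F x
  have hi' : IsIntegral F x⁻¹ := IsIntegral.of_finite F x⁻¹
  have hc : (minpoly F x).coeff 0 ≠ 0 := fun h => hx ((minpoly.coeff_zero_eq_zero hi).1 h)
  have hadj : F⟮x⁻¹⟯ = F⟮x⟯ := by
    apply le_antisymm
    · rw [adjoin_simple_le_iff]; exact inv_mem (mem_adjoin_simple_self F x)
    · rw [adjoin_simple_le_iff]
      have := inv_mem (mem_adjoin_simple_self F x⁻¹)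
      rwa [inv_inv] at this
  have hdeg : (minpoly F x⁻¹).natDegree = (minpoly F x).natDegree := by
    rw [← adjoin.finrank hi, ← adjoin.finrank hi', hadj]
  have hpos : 0 < (minpoly F x).natDegree := minpoly.natDegree_pos hi
  have htr : (minpoly F x).natTrailingDegree = 0 := by
    rw [natTrailingDegree_eq_zero]; exact Or.inr hc
  have hrd : (minpoly F x).reverse.natDegree = (minpoly F x).natDegree := by
    rw [reverse_natDegree, htr, Nat.sub_zero]
  set p' : F[X] := C ((minpoly F x).coeff 0)⁻¹ * (minpoly F x).reverse with hp'
  have hpd : p'.natDegree = (minpoly F x).natDegree := by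
    rw [hp', natDegree_C_mul (inv_ne_zero hc), hrd]
  have hpm : p'.Monic := by
    rw [Monic, hp', leadingCoeff_mul, leadingCoeff_C, reverse_leadingCoeff, trailingCoeff, htr,
      inv_mul_cancel₀ hc]
  have hev : aeval x⁻¹ p' = 0 := by
    have : Invertible x := invertibleOfNonzero hx
    have h := (eval₂_reverse_eq_zero_iff (algebraMap F K) x (minpoly F x)).2 (by
      have := minpoly.aeval F x
      rwa [aeval_def] at this)
    rw [invOf_eq_inv] at h
    rw [hp', map_mul, aeval_def (x := x⁻¹) (p := reverse _), h, mul_zero]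
  have heq : minpoly F x⁻¹ = p' := by
    symm
    apply eq_of_monic_of_dvd_of_natDegree_le (minpoly.monic hi') hpm (minpoly.dvd F _ hev)
    rw [hpd, hdeg]
  rw [heq, nextCoeff_of_natDegree_pos (by rw [hpd]; exact hpos), hpd, hp', coeff_C_mul, coeff_reverse,
    revAt_le (by omega)]
  rw [show (minpoly F x).natDegree - ((minpoly F x).natDegree - 1) = 1 by omega]
  rw [div_eq_mul_inv, mul_comm]

lemma klam_minpoly (ψ : AddChar F ℂ) (a b : F) (x : K) (hx : x ≠ 0) (e : ℕ)
    (he : (minpoly F x).natDegree * e = Module.finrank F K) :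
    klam ψ a b (minpoly F x) ^ e =
      ψ (Algebra.trace F K (algebraMap F K a * x + algebraMap F K b * x⁻¹)) := by
  have hi : IsIntegral F x := IsIntegral.of_finite F x
  have hc : (minpoly F x).coeff 0 ≠ 0 := fun h => hx ((minpoly.coeff_zero_eq_zero hi).1 h)
  have hpos : 0 < (minpoly F x).natDegree := minpoly.natDegree_pos hi
  have hadj : F⟮x⁻¹⟯ = F⟮x⟯ := by
    apply le_antisymm
    · rw [adjoin_simple_le_iff]; exact inv_mem (mem_adjoin_simple_self F x)
    · rw [adjoin_simple_le_iff]
      have := inv_mem (mem_adjoin_simple_self F x⁻¹)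
      rwa [inv_inv] at this
  have hfe : Module.finrank F⟮x⟯ K = e := by
    have h1 := Module.finrank_mul_finrank F F⟮x⟯ K
    rw [adjoin.finrank hi, ← he] at h1
    exact Nat.eq_of_mul_eq_mul_left hpos h1
  have hfe' : Module.finrank F⟮x⁻¹⟯ K = e := by rw [hadj, hfe]
  rw [klam, if_neg hc, ← AddChar.map_nsmul_eq_pow]
  congr 1
  rw [map_add, ← Algebra.smul_def, ← Algebra.smul_def, map_smul, map_smul,
    trace_eq_finrank_mul_minpoly_nextCoeff F x, trace_eq_finrank_mul_minpoly_nextCoeff F x⁻¹, hfe, hfe',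
    minpoly_inv_nextCoeff x hx]
  simp only [nsmul_eq_mul, smul_eq_mul]
  ring

lemma fiber_card (π : F[X]) (d : ℕ) (hπ : π ∈ Ir F d) (hd : d ∣ Module.finrank F K) :
    (Finset.univ.filter fun x : K => minpoly F x = π).card = d := by
  rw [mem_Ir] at hπ
  obtain ⟨hm, hirr, hdeg⟩ := hπ
  have hdv : π ∣ X ^ Fintype.card K - X := by
    have := (hirr.natDegree_dvd_iff_dvd_X_pow_card_pow_sub_X (n := Module.finrank F K)).1 (by rw [hdeg]; exact hd)
    rwa [Nat.card_eq_fintype_card, ← Module.card_eq_pow_finrank] at this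
  have hne : (X ^ Fintype.card K - X : K[X]) ≠ 0 := FiniteField.X_pow_card_sub_X_ne_zero K Fintype.one_lt_card
  have hsp : (X ^ Fintype.card K - X : K[X]).Splits := by
    rw [splits_iff_card_roots, FiniteField.roots_X_pow_card_sub_X,
      FiniteField.X_pow_card_sub_X_natDegree_eq K Fintype.one_lt_card]
    rfl
  have hsp2 : (map (algebraMap F K) π).Splits := by
    refine hsp.of_dvd hne ?_
    have := Polynomial.map_dvd (algebraMap F K) hdv
    simpa using this
  have h := card_rootSet_eq_natDegree (K := K) (PerfectField.separable_of_irreducible hirr) hsp2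
  rw [← hdeg, ← h, ← Set.toFinset_card]
  congr 1
  ext x
  simp only [Finset.mem_filter, Finset.mem_univ, true_and, Set.mem_toFinset, mem_rootSet]
  constructor
  · rintro rfl; exact ⟨hm.ne_zero, minpoly.aeval F x⟩
  · rintro ⟨_, h⟩; exact (minpoly.eq_of_irreducible_of_monic hirr h hm).symm

lemma Kp_eq (ψ : AddChar F ℂ) (a b : F) (n : ℕ) (hn : Module.finrank F K = n) :
    Kp (klam ψ a b) n = ∑ x ∈ Finset.univ.filter (fun x : K => x ≠ 0),
      ψ (Algebra.trace F K (algebraMap F K a * x + algebraMap F K b * x⁻¹)) := by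
  have hn0 : n ≠ 0 := by rw [← hn]; exact Module.finrank_pos.ne'
  have hdvd : ∀ x : K, (minpoly F x).natDegree * (n / (minpoly F x).natDegree) = n := by
    intro x
    refine Nat.mul_div_cancel' ?_
    rw [← hn]; exact minpoly.degree_dvd (IsIntegral.of_finite F x)
  have h1 : ∑ x ∈ Finset.univ.filter (fun x : K => x ≠ 0),
      ψ (Algebra.trace F K (algebraMap F K a * x + algebraMap F K b * x⁻¹)) =
      ∑ x : K, klam ψ a b (minpoly F x) ^ (n / (minpoly F x).natDegree) := by
    rw [Finset.sum_filter]
    refine Finset.sum_congr rfl fun x _ => ?_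
    split_ifs with hx
    · rw [klam_minpoly ψ a b x hx _ ((hdvd x).trans hn.symm)]
    · push Not at hx
      subst hx
      rw [minpoly.zero, klam]
      simp [hn0]
  rw [h1, ← Finset.sum_fiberwise_of_maps_to (t := n.divisorsAntidiagonal)
    (g := fun x : K => ((minpoly F x).natDegree, n / (minpoly F x).natDegree))]
  swap
  · intro x _
    rw [Nat.mem_divisorsAntidiagonal]
    exact ⟨hdvd x, hn0⟩
  rw [Kp]
  refine Finset.sum_congr rfl ?_
  rintro ⟨d, e⟩ hde
  rw [Nat.mem_divisorsAntidiagonal] at hde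
  simp only at hde ⊢
  have hd0 : 0 < d := Nat.pos_of_ne_zero (by rintro rfl; simp at hde; omega)
  have hq : n / d = e := by rw [← hde.1, Nat.mul_div_cancel_left _ hd0]
  rw [← Finset.sum_fiberwise_of_maps_to (t := Ir F d) (g := fun x : K => minpoly F x)]
  swap
  · intro x hx
    simp only [Finset.mem_filter, Prod.mk.injEq] at hx
    rw [mem_Ir]
    exact ⟨minpoly.monic (IsIntegral.of_finite F x), minpoly.irreducible (IsIntegral.of_finite F x), hx.2.1⟩
  refine Finset.sum_congr rfl fun π hπ => ?_
  have hπ' := hπ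
  rw [mem_Ir] at hπ'
  have hset : ((Finset.univ.filter fun x : K => ((minpoly F x).natDegree, n / (minpoly F x).natDegree) = (d, e)).filter
      fun x => minpoly F x = π) = Finset.univ.filter fun x : K => minpoly F x = π := by
    ext x
    simp only [Finset.mem_filter, Finset.mem_univ, true_and, Prod.mk.injEq]
    constructor
    · exact fun h => h.2
    · intro h
      rw [h, hπ'.2.2]
      exact ⟨⟨rfl, hq⟩, rfl⟩
  rw [hset, Finset.sum_congr rfl (g := fun _ => klam ψ a b π ^ e)]
  · rw [Finset.sum_const, fiber_card π d hπ (by rw [hn]; exact ⟨e, hde.1.symm⟩), nsmul_eq_mul]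
  · intro x hx
    rw [Finset.mem_filter] at hx
    rw [hx.2, hπ'.2.2, hq]

end lext

section kl
open scoped Classical
variable {F : Type} [Field F] [Fintype F]

theorem kloosterman (hF : 3 ≤ Fintype.card F) (ψ : AddChar F ℂ) (hψ : ψ ≠ 1) (a b : F) (ha : a ≠ 0) :
    ‖∑ x ∈ Finset.univ.filter (fun x : F => x ≠ 0), ψ (a * x + b * x⁻¹)‖ ≤ 2 * Real.sqrt (Fintype.card F) := by
  set lam := klam ψ a b with hlam
  have hN := fun n => newton lam (klam_mul ψ a b) (klam_one ψ a b) n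
  have hL0 : Ls lam 0 = 1 := Ls_zero ψ a b
  have hL3 : ∀ n, 3 ≤ n → Ls lam n = 0 := Ls_ge_three ψ hψ a b ha
  have hk1 : Kp lam 1 = ∑ x ∈ Finset.univ.filter (fun x : F => x ≠ 0), ψ (a * x + b * x⁻¹) := by
    rw [hlam, Kp_eq (K := F) ψ a b 1 (Module.finrank_self F)]
    simp
  have h1 : Kp lam 1 = Ls lam 1 := by
    have := hN 1
    simp [hL0] at this
    exact this.symm
  rw [← hk1, h1]
  obtain ⟨p, hp⟩ := CharP.exists F
  have hpp : Fact p.Prime := ⟨CharP.char_is_prime F p⟩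
  refine rec_bound (Kp lam) (Ls lam 1) (Ls lam 2) h1 ?_ ?_ (Fintype.card F) (19 * Fintype.card F) (by
    exact_mod_cast (by omega : 0 < Fintype.card F)) ?_
  · have := hN 2
    rw [Finset.sum_Icc_succ_top (by norm_num)] at this
    simp [hL0] at this
    exact this
  · intro n
    have := hN (n + 3)
    rw [hL3 _ (by omega), mul_zero, Finset.sum_Icc_succ_top (by omega), Finset.sum_Icc_succ_top (by omega),
      Finset.sum_Icc_succ_top (by omega), Finset.sum_eq_zero] at this
    · rw [show n + 2 + 1 - (n + 1) = 2 by omega, show n + 2 + 1 - (n + 1 + 1) = 1 by omega,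
        show n + 3 - (n + 2 + 1) = 0 by omega, hL0] at this
      linear_combination -this
    · intro j hj
      rw [Finset.mem_Icc] at hj
      rw [hL3 _ (by omega), mul_zero]
  · intro m hm
    have : NeZero (2 * m) := ⟨by omega⟩
    have : Fintype (FiniteField.Extension F p (2 * m)) := Fintype.ofFinite _
    rw [hlam, Kp_eq (K := FiniteField.Extension F p (2 * m)) ψ a b (2 * m) (FiniteField.finrank_extension F p (2 * m))]
    refine kloos_ext_bound m hm ?_ hF a b ha ψ hψ
    have := FiniteField.natCard_extension F p (2 * m)
    rwa [Nat.card_eq_fintype_card, Nat.card_eq_fintype_card] at this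
end kl
section salie
variable {F : Type} [Field F] [Fintype F] [DecidableEq F]

/-- complex valued quadratic character -/
noncomputable def eta (F : Type) [Field F] [Fintype F] [DecidableEq F] : MulChar F ℂ :=
  (quadraticChar F).ringHomComp (Int.castRingHom ℂ)

lemma eta_apply (a : F) : eta F a = ((quadraticChar F a : ℤ) : ℂ) := rfl

lemma eta_sq {a : F} (ha : a ≠ 0) : eta F a ^ 2 = 1 := by
  rw [eta_apply]
  exact_mod_cast quadraticChar_sq_one ha

lemma eta_inv {a : F} (ha : a ≠ 0) : eta F a⁻¹ = eta F a := by
  have h1 : eta F a⁻¹ * eta F a = 1 := by rw [← map_mul, inv_mul_cancel₀ ha, map_one]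
  have h2 := eta_sq ha
  linear_combination (eta F a) * h1 - eta F a⁻¹ * h2

lemma eta_norm {a : F} (ha : a ≠ 0) : ‖eta F a‖ = 1 := by
  have h := congrArg norm (eta_sq ha)
  rw [norm_pow, norm_one] at h
  exact (pow_eq_one_iff_of_nonneg (norm_nonneg _) two_ne_zero).1 h

lemma prim_ne_one {ψ : AddChar F ℂ} (hψ : ψ.IsPrimitive) : ψ ≠ 1 := by
  have := hψ (one_ne_zero (α := F))
  rwa [AddChar.mulShift_one] at this

lemma gauss_norm (h2 : ringChar F ≠ 2) {ψ : AddChar F ℂ} (hψ : ψ.IsPrimitive) :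
    ‖gaussSum (eta F) ψ‖ = Real.sqrt (Fintype.card F) := by
  have hne : eta F ≠ 1 := (MulChar.ringHomComp_ne_one_iff
    (RingHom.injective_int (Int.castRingHom ℂ))).2 (quadraticChar_ne_one h2)
  have hq : (eta F).IsQuadratic := (quadraticChar_isQuadratic F).comp _
  have h := congrArg norm (gaussSum_sq hne hq hψ)
  rw [norm_pow, norm_mul, eta_norm (neg_ne_zero.2 one_ne_zero), one_mul, Complex.norm_natCast] at h
  rw [← h, Real.sqrt_sq (norm_nonneg _)]

lemma eta_shift {ψ : AddChar F ℂ} {s : F} (hs : s ≠ 0) :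
    ∑ a, eta F a * ψ (s * a) = eta F s * gaussSum (eta F) ψ := by
  rw [gaussSum, ← Equiv.sum_comp (Equiv.mulLeft₀ s hs) (fun a => eta F a * ψ a), Finset.mul_sum]
  refine Finset.sum_congr rfl fun a _ => ?_
  change _ = eta F s * (eta F (s * a) * ψ (s * a))
  rw [map_mul (eta F)]
  linear_combination (-eta F a * ψ (s * a)) * eta_sq hs

lemma quad_sum (h2 : ringChar F ≠ 2) {ψ : AddChar F ℂ} (hψ : ψ.IsPrimitive) {s : F} (hs : s ≠ 0) :
    ∑ y, ψ (s * y ^ 2) = eta F s * gaussSum (eta F) ψ := by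
  rw [← eta_shift hs]
  have h1 : ∑ a : F, ψ (s * a) = 0 := by
    have := AddChar.sum_mulShift s hψ
    rw [if_neg hs] at this
    simpa [mul_comm] using this
  have h3 : ∑ a, eta F a * ψ (s * a) = ∑ a, (eta F a + 1) * ψ (s * a) := by
    simp only [add_mul, one_mul, Finset.sum_add_distrib, h1, add_zero]
  rw [h3, ← Finset.sum_fiberwise Finset.univ (fun y : F => y ^ 2)]
  refine Finset.sum_congr rfl fun a _ => ?_
  rw [Finset.sum_congr rfl (g := fun _ => ψ (s * a))]
  · rw [Finset.sum_const, nsmul_eq_mul]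
    congr 1
    have := quadraticChar_card_sqrts h2 a
    rw [eta_apply]
    have h4 : ({x : F | x ^ 2 = a}.toFinset) = Finset.univ.filter fun y => y ^ 2 = a := by
      ext; simp
    rw [h4] at this
    exact_mod_cast this
  · intro y hy
    rw [Finset.mem_filter] at hy
    rw [hy.2]

lemma two_ne (h2 : ringChar F ≠ 2) : (2 : F) ≠ 0 := Ring.two_ne_zero h2

/-- completing the square -/
lemma quad_sum_lin (h2 : ringChar F ≠ 2) {ψ : AddChar F ℂ} (hψ : ψ.IsPrimitive) {s : F} (hs : s ≠ 0) (c : F) :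
    ∑ y, ψ (s * y ^ 2 + 2 * c * y) = eta F s * gaussSum (eta F) ψ * ψ (-(c ^ 2 * s⁻¹)) := by
  rw [← quad_sum h2 hψ hs, ← Equiv.sum_comp (Equiv.addRight (c * s⁻¹)) (fun y => ψ (s * y ^ 2)), Finset.sum_mul]
  refine Finset.sum_congr rfl fun y _ => ?_
  rw [← AddChar.map_add_eq_mul]
  congr 1
  simp only [Equiv.coe_addRight]
  field_simp
  ring

lemma salie (h2 : ringChar F ≠ 2) {ψ : AddChar F ℂ} (hψ : ψ.IsPrimitive) (c : F) :
    ‖∑ s ∈ Finset.univ.filter (fun s : F => s ≠ 0), eta F s * ψ (-s - c * s⁻¹)‖ ≤ 2 * Real.sqrt (Fintype.card F) := by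
  set r := Real.sqrt (Fintype.card F) with hr
  have hr0 : 0 < r := Real.sqrt_pos.2 (by exact_mod_cast Fintype.card_pos)
  have hrr : r * r = Fintype.card F := Real.mul_self_sqrt (by positivity)
  have hG := gauss_norm h2 hψ
  by_cases hc0 : c = 0
  · subst hc0
    have : ∑ s ∈ Finset.univ.filter (fun s : F => s ≠ 0), eta F s * ψ (-s - 0 * s⁻¹) = ∑ a, eta F a * ψ (-1 * a) := by
      rw [Finset.sum_filter]
      refine Finset.sum_congr rfl fun s _ => ?_
      split_ifs with h
      · congr 2; ring
      · push Not at h; rw [h, MulChar.map_zero, zero_mul]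
    rw [this, eta_shift (neg_ne_zero.2 one_ne_zero), norm_mul, eta_norm (neg_ne_zero.2 one_ne_zero), hG]
    linarith
  by_cases hsq : IsSquare c
  · obtain ⟨γ, hγ⟩ := hsq
    have hγ0 : γ ≠ 0 := by rintro rfl; simp at hγ; exact hc0 hγ
    set T := ∑ s ∈ Finset.univ.filter (fun s : F => s ≠ 0), eta F s * ψ (-s - c * s⁻¹) with hT
    have h1 : gaussSum (eta F) ψ * T = ∑ y : F, ψ (2 * γ * y) * ((if y ^ 2 - 1 = 0 then (Fintype.card F : ℂ) else 0) - 1) := by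
      calc gaussSum (eta F) ψ * T = ∑ s ∈ Finset.univ.filter (fun s : F => s ≠ 0), ψ (-s) * ∑ y, ψ (s * y ^ 2 + 2 * γ * y) := by
            rw [hT, Finset.mul_sum]
            refine Finset.sum_congr rfl fun s hs => ?_
            rw [Finset.mem_filter] at hs
            rw [quad_sum_lin h2 hψ hs.2, sub_eq_add_neg, AddChar.map_add_eq_mul, hγ, sq]
            ring
        _ = ∑ y : F, ψ (2 * γ * y) * ∑ s ∈ Finset.univ.filter (fun s : F => s ≠ 0), ψ (s * (y ^ 2 - 1)) := by
            simp only [Finset.mul_sum]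
            rw [Finset.sum_comm]
            refine Finset.sum_congr rfl fun y _ => Finset.sum_congr rfl fun s _ => ?_
            rw [← AddChar.map_add_eq_mul, ← AddChar.map_add_eq_mul]
            congr 1; ring
        _ = _ := by
            refine Finset.sum_congr rfl fun y _ => ?_
            congr 1
            have h := AddChar.sum_mulShift (y ^ 2 - 1) hψ
            rw [Finset.filter_ne' Finset.univ (0 : F), Finset.sum_erase_eq_sub (Finset.mem_univ _), h]
            simp
    have h3 : ∑ y : F, ψ (2 * γ * y) = 0 := by
      have h := AddChar.sum_mulShift (2 * γ) hψ
      rw [if_neg (mul_ne_zero (two_ne h2) hγ0)] at h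
      simpa [mul_comm] using h
    have h4 : gaussSum (eta F) ψ * T = ∑ y ∈ Finset.univ.filter (fun y : F => y ^ 2 - 1 = 0), ψ (2 * γ * y) * (Fintype.card F : ℂ) := by
      rw [h1]
      simp only [mul_sub, mul_one, Finset.sum_sub_distrib, h3, sub_zero, mul_ite, mul_zero]
      rw [Finset.sum_filter]
    have h5 : ‖gaussSum (eta F) ψ * T‖ ≤ 2 * (r * r) := by
      rw [h4]
      refine (norm_sum_le _ _).trans ?_
      simp only [norm_mul, AddChar.norm_apply, Complex.norm_natCast, one_mul, Finset.sum_const, nsmul_eq_mul]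
      rw [← hrr]
      gcongr
      have : (Finset.univ.filter (fun y : F => y ^ 2 - 1 = 0)) ⊆ {1, -1} := by
        intro y hy
        simp only [Finset.mem_filter, Finset.mem_univ, true_and] at hy
        simp only [Finset.mem_insert, Finset.mem_singleton]
        have h6 : (y - 1) * (y + 1) = 0 := by linear_combination hy
        rcases mul_eq_zero.1 h6 with h | h
        · exact Or.inl (sub_eq_zero.1 h)
        · exact Or.inr (eq_neg_of_add_eq_zero_left h)
      exact_mod_cast (Finset.card_le_card this).trans Finset.card_le_two
    rw [norm_mul, hG] at h5
    nlinarith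
  · have hη : eta F c = -1 := by
      rw [eta_apply, quadraticChar_neg_one_iff_not_isSquare.2 hsq]; simp
    have h0 : ∑ s ∈ Finset.univ.filter (fun s : F => s ≠ 0), eta F s * ψ (-s - c * s⁻¹) =
        - ∑ s ∈ Finset.univ.filter (fun s : F => s ≠ 0), eta F s * ψ (-s - c * s⁻¹) := by
      rw [← Finset.sum_neg_distrib]
      refine Finset.sum_bij' (fun s _ => c * s⁻¹) (fun s _ => c * s⁻¹) ?_ ?_ ?_ ?_ ?_
      · intro s hs; simp at hs ⊢; exact ⟨hc0, hs⟩
      · intro s hs; simp at hs ⊢; exact ⟨hc0, hs⟩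
      · intro s hs; simp at hs; field_simp
      · intro s hs; simp at hs; field_simp
      · intro s hs
        simp only [Finset.mem_filter, Finset.mem_univ, true_and] at hs
        rw [map_mul, hη, eta_inv hs]
        have : -(c * s⁻¹) - c * (c * s⁻¹)⁻¹ = -s - c * s⁻¹ := by field_simp; ring
        rw [this]; ring
    have : ∑ s ∈ Finset.univ.filter (fun s : F => s ≠ 0), eta F s * ψ (-s - c * s⁻¹) = 0 := by
      linear_combination h0 / 2
    rw [this, norm_zero]; positivity

/-- the uniform bound -/
lemma S_bound (h2 : ringChar F ≠ 2) {ψ : AddChar F ℂ} (hψ : ψ.IsPrimitive) (d : ℕ) (c : F) :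
    ‖∑ s ∈ Finset.univ.filter (fun s : F => s ≠ 0), eta F s ^ d * ψ (-s - c * s⁻¹)‖ ≤ 2 * Real.sqrt (Fintype.card F) := by
  have h3 : 3 ≤ Fintype.card F := by
    have := FiniteField.odd_card_of_char_ne_two h2
    have := Fintype.one_lt_card (α := F)
    omega
  rcases Nat.even_or_odd d with hd | hd
  · obtain ⟨e, rfl⟩ := hd
    have h := kloosterman h3 ψ (prim_ne_one hψ) (-1) (-c) (neg_ne_zero.2 one_ne_zero)
    refine le_trans (le_of_eq ?_) h
    congr 1
    refine Finset.sum_congr (by ext; simp) fun s hs => ?_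
    have hs : s ≠ 0 := by simpa using hs
    rw [← two_mul, pow_mul, eta_sq hs, one_pow, one_mul]
    congr 1; ring
  · obtain ⟨e, rfl⟩ := hd
    convert salie h2 hψ c using 2
    refine Finset.sum_congr (by congr) fun s hs => ?_
    rw [Finset.mem_filter] at hs
    rw [pow_succ, pow_mul, eta_sq hs.2, one_pow, one_mul]
end salie
section fourier
variable {F : Type} [Field F] [Fintype F] [DecidableEq F] {d : ℕ}

lemma char_sum {ι : Type} (ψ : AddChar F ℂ) (s : Finset ι) (f : ι → F) : ψ (∑ i ∈ s, f i) = ∏ i ∈ s, ψ (f i) := by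
  classical
  induction s using Finset.induction_on with
  | empty => simp
  | insert a s ha ih => rw [Finset.sum_insert ha, Finset.prod_insert ha, AddChar.map_add_eq_mul, ih]

/-- Orthogonality. -/
lemma orth {ψ : AddChar F ℂ} (hψ : ψ.IsPrimitive) (w : Fin d → F) :
    ∑ ξ : Fin d → F, ψ (∑ j, ξ j * w j) = if w = 0 then (Fintype.card F : ℂ) ^ d else 0 := by
  simp only [char_sum]
  rw [← Fintype.prod_sum (fun (j : Fin d) (t : F) => ψ (t * w j))]
  simp only [AddChar.sum_mulShift _ hψ]
  split_ifs with h
  · subst h; simp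
  · obtain ⟨j, hj⟩ := Function.ne_iff.1 h
    refine Finset.prod_eq_zero (Finset.mem_univ j) ?_
    simp only [Pi.zero_apply] at hj
    rw [if_neg hj]; simp

lemma plancherel {ψ : AddChar F ℂ} (hψ : ψ.IsPrimitive) (f : (Fin d → F) → ℝ) (ε : F) (hε : ε ≠ 0) :
    ∑ ξ : Fin d → F, ‖∑ x, (f x : ℂ) * ψ (ε * ∑ j, ξ j * x j)‖ ^ 2 = (Fintype.card F : ℝ) ^ d * ∑ x, f x ^ 2 := by
  have h : ((∑ ξ : Fin d → F, ‖∑ x, (f x : ℂ) * ψ (ε * ∑ j, ξ j * x j)‖ ^ 2 : ℝ) : ℂ) =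
      (((Fintype.card F : ℝ) ^ d * ∑ x, f x ^ 2 : ℝ) : ℂ) := by
    push_cast
    have h1 : ∀ ξ : Fin d → F, ((‖∑ x, (f x : ℂ) * ψ (ε * ∑ j, ξ j * x j)‖ : ℂ)) ^ 2 =
        ∑ x, ∑ y, (f x : ℂ) * f y * ψ (∑ j, ξ j * (ε * (x j - y j))) := by
      intro ξ
      rw [← Complex.mul_conj', map_sum, Finset.sum_mul_sum]
      refine Finset.sum_congr rfl fun x _ => Finset.sum_congr rfl fun y _ => ?_
      rw [map_mul (starRingEnd ℂ), Complex.conj_ofReal, ← AddChar.map_neg_eq_conj]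
      have : ∑ j, ξ j * (ε * (x j - y j)) = ε * ∑ j, ξ j * x j + -(ε * ∑ j, ξ j * y j) := by
        rw [Finset.mul_sum, Finset.mul_sum, ← sub_eq_add_neg, ← Finset.sum_sub_distrib]
        exact Finset.sum_congr rfl fun j _ => by ring
      rw [this, AddChar.map_add_eq_mul]
      ring
    simp only [h1]
    rw [Finset.sum_comm, Finset.mul_sum]
    refine Finset.sum_congr rfl fun x _ => ?_
    rw [Finset.sum_comm]
    have h2 : ∀ y, ∑ ξ : Fin d → F, (f x : ℂ) * f y * ψ (∑ j, ξ j * (ε * (x j - y j))) =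
        if y = x then (Fintype.card F : ℂ) ^ d * (f x : ℂ) ^ 2 else 0 := by
      intro y
      rw [← Finset.mul_sum]
      have h3 := orth hψ (fun j => ε * (x j - y j))
      rw [h3]
      by_cases hxy : y = x
      · subst hxy
        rw [if_pos rfl, if_pos (by funext j; simp)]
        ring
      · rw [if_neg hxy, if_neg, mul_zero]
        intro h4
        apply hxy
        funext j
        have := congrFun h4 j
        simp only [Pi.zero_apply, mul_eq_zero, hε, false_or] at this
        exact (sub_eq_zero.1 this).symm
    simp only [h2]
    simp
  exact_mod_cast h

/-- multi-dimensional completion of squares -/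
lemma square_expand (h2 : ringChar F ≠ 2) {ψ : AddChar F ℂ} (hψ : ψ.IsPrimitive) {s : F} (hs : s ≠ 0) (w : Fin d → F) :
    (eta F (-1) * gaussSum (eta F) ψ) ^ d * ψ (s * ∑ j, w j ^ 2) =
      eta F s ^ d * ∑ ξ : Fin d → F, ψ (∑ j, ξ j * w j) * ψ (-((∑ j, ξ j ^ 2) / 4 * s⁻¹)) := by
  have h4 : (4 : F) ≠ 0 := by
    have := two_ne h2
    have h : (4 : F) = 2 * 2 := by norm_num
    rw [h]; exact mul_ne_zero this this
  have hσ : -(4 * s)⁻¹ ≠ 0 := neg_ne_zero.2 (inv_ne_zero (mul_ne_zero h4 hs))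
  have he4 : eta F 4 = 1 := by
    have h : (4 : F) = 2 ^ 2 := by norm_num
    rw [h, map_pow, eta_sq (two_ne h2)]
  have heσ : eta F (-(4 * s)⁻¹) = eta F (-1) * eta F s := by
    rw [← neg_one_mul, map_mul, eta_inv (mul_ne_zero h4 hs), map_mul, he4, one_mul]
  have h1 : ∀ j : Fin d, ∑ t : F, ψ (t * w j + -(t ^ 2 / 4 * s⁻¹)) =
      eta F (-1) * eta F s * gaussSum (eta F) ψ * ψ (s * w j ^ 2) := by
    intro j
    have h := quad_sum_lin h2 hψ hσ (w j / 2)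
    rw [heσ] at h
    have e1 : -((w j / 2) ^ 2 * (-(4 * s)⁻¹)⁻¹) = s * w j ^ 2 := by
      rw [inv_neg, inv_inv]
      have := two_ne h2
      field_simp
      ring
    rw [e1] at h
    rw [← h]
    refine Finset.sum_congr rfl fun t _ => ?_
    congr 1
    have := two_ne h2
    field_simp
    ring
  have h3 : ∑ ξ : Fin d → F, ψ (∑ j, ξ j * w j) * ψ (-((∑ j, ξ j ^ 2) / 4 * s⁻¹)) =
      ∏ j : Fin d, ∑ t : F, ψ (t * w j + -(t ^ 2 / 4 * s⁻¹)) := by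
    rw [Fintype.prod_sum (fun (j : Fin d) (t : F) => ψ (t * w j + -(t ^ 2 / 4 * s⁻¹)))]
    refine Finset.sum_congr rfl fun ξ _ => ?_
    rw [← char_sum, Finset.sum_add_distrib, AddChar.map_add_eq_mul, Finset.sum_neg_distrib, ← Finset.sum_mul,
      ← Finset.sum_div]
  rw [h3, Finset.prod_congr rfl fun j _ => h1 j, Finset.prod_mul_distrib, Finset.prod_const, ← char_sum,
    ← Finset.mul_sum, Finset.card_univ, Fintype.card_fin]
  have h5 : eta F s ^ d * eta F s ^ d = 1 := by rw [← pow_add, ← two_mul, pow_mul, eta_sq hs, one_pow]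
  rw [mul_pow, mul_pow, mul_pow]
  linear_combination (-(eta F (-1) ^ d * gaussSum (eta F) ψ ^ d * ψ (s * ∑ j, w j ^ 2))) * h5

lemma kernel_expand (h2 : ringChar F ≠ 2) {ψ : AddChar F ℂ} (hψ : ψ.IsPrimitive) (w : Fin d → F) :
    (eta F (-1) * gaussSum (eta F) ψ) ^ d * ((Fintype.card F : ℂ) * (if ∑ j, w j ^ 2 = 1 then 1 else 0) - 1) =
      ∑ ξ : Fin d → F, (∑ s ∈ Finset.univ.filter (fun s : F => s ≠ 0),
        eta F s ^ d * ψ (-s - ((∑ j, ξ j ^ 2) / 4) * s⁻¹)) * ψ (∑ j, ξ j * w j) := by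
  have h1 : (Fintype.card F : ℂ) * (if ∑ j, w j ^ 2 = 1 then 1 else 0) - 1 =
      ∑ s ∈ Finset.univ.filter (fun s : F => s ≠ 0), ψ (s * (∑ j, w j ^ 2)) * ψ (-s) := by
    have h := AddChar.sum_mulShift (∑ j, w j ^ 2 - 1) hψ
    simp only [← AddChar.map_add_eq_mul]
    rw [Finset.filter_ne' Finset.univ (0 : F), Finset.sum_erase_eq_sub (Finset.mem_univ _)]
    have h3 : ∀ s : F, s * (∑ j, w j ^ 2) + -s = s * (∑ j, w j ^ 2 - 1) := fun s => by ring
    simp only [h3, h]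
    simp [sub_eq_zero]
  rw [h1, Finset.mul_sum]
  simp only [Finset.sum_mul]
  rw [Finset.sum_comm]
  refine Finset.sum_congr rfl fun s hs => ?_
  rw [Finset.mem_filter] at hs
  rw [← mul_assoc, square_expand h2 hψ hs.2, Finset.mul_sum, Finset.sum_mul]
  refine Finset.sum_congr rfl fun ξ _ => ?_
  rw [sub_eq_add_neg, AddChar.map_add_eq_mul]
  ring

theorem bilin (h2 : ringChar F ≠ 2) (f g : (Fin d → F) → ℝ) :
    |∑ x, ∑ y, f x * g y * (if ∑ j, (x j - y j) ^ 2 = 1 then 1 else 0) -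
      (∑ x, f x) * (∑ y, g y) / Fintype.card F| * Real.sqrt (Fintype.card F)
      ≤ 2 * Real.sqrt (Fintype.card F) ^ d * (Real.sqrt (∑ x, f x ^ 2) * Real.sqrt (∑ y, g y ^ 2)) := by
  set ψ : AddChar F ℂ := AddChar.FiniteField.primitiveChar_to_Complex F with hψd
  have hψ : ψ.IsPrimitive := AddChar.FiniteField.primitiveChar_to_Complex_isPrimitive F
  set r := Real.sqrt (Fintype.card F) with hr
  have hr0 : 0 < r := Real.sqrt_pos.2 (by exact_mod_cast Fintype.card_pos)
  have hrr : r ^ 2 = Fintype.card F := Real.sq_sqrt (by positivity)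
  have hq0 : (Fintype.card F : ℝ) ≠ 0 := by rw [← hrr]; positivity
  set D := ∑ x, ∑ y, f x * g y * (if ∑ j, (x j - y j) ^ 2 = 1 then 1 else 0) -
      (∑ x, f x) * (∑ y, g y) / Fintype.card F with hD
  set S : (Fin d → F) → ℂ := fun ξ => ∑ s ∈ Finset.univ.filter (fun s : F => s ≠ 0),
        eta F s ^ d * ψ (-s - ((∑ j, ξ j ^ 2) / 4) * s⁻¹) with hS
  set A : (Fin d → F) → ℂ := fun ξ => ∑ x, (f x : ℂ) * ψ (1 * ∑ j, ξ j * x j) with hA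
  set B : (Fin d → F) → ℂ := fun ξ => ∑ x, (g x : ℂ) * ψ (-1 * ∑ j, ξ j * x j) with hB
  have hDq : (Fintype.card F : ℝ) * D = ∑ x, ∑ y, f x * g y * ((Fintype.card F : ℝ) * (if ∑ j, (x j - y j) ^ 2 = 1 then 1 else 0) - 1) := by
    have : (Fintype.card F : ℝ) * D = (Fintype.card F : ℝ) * (∑ x, ∑ y, f x * g y * (if ∑ j, (x j - y j) ^ 2 = 1 then 1 else 0)) - (∑ x, f x) * (∑ y, g y) := by
      rw [hD]; field_simp
    rw [this, Finset.sum_mul_sum, Finset.mul_sum, ← Finset.sum_sub_distrib]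
    refine Finset.sum_congr rfl fun x _ => ?_
    rw [Finset.mul_sum, ← Finset.sum_sub_distrib]
    refine Finset.sum_congr rfl fun y _ => ?_
    ring
  have key : (eta F (-1) * gaussSum (eta F) ψ) ^ d * (((Fintype.card F : ℝ) * D : ℝ) : ℂ) = ∑ ξ, S ξ * (A ξ * B ξ) := by
    rw [hDq]
    push_cast
    have h1 : ∀ x y : Fin d → F, (eta F (-1) * gaussSum (eta F) ψ) ^ d *
        ((f x : ℂ) * g y * ((Fintype.card F : ℂ) * (if ∑ j, (x j - y j) ^ 2 = 1 then 1 else 0) - 1)) =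
        ∑ ξ, S ξ * ((f x : ℂ) * ψ (1 * ∑ j, ξ j * x j) * ((g y : ℂ) * ψ (-1 * ∑ j, ξ j * y j))) := by
      intro x y
      have h := kernel_expand h2 hψ (fun j => x j - y j)
      rw [mul_left_comm, h, Finset.mul_sum]
      refine Finset.sum_congr rfl fun ξ _ => ?_
      have e : ∑ j, ξ j * (x j - y j) = 1 * ∑ j, ξ j * x j + -1 * ∑ j, ξ j * y j := by
        simp only [mul_sub, Finset.sum_sub_distrib]; ring
      rw [e, AddChar.map_add_eq_mul]
      simp only [hS]
      ring
    rw [Finset.mul_sum]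
    simp only [Finset.mul_sum]
    have h3 : ∀ ξ, S ξ * (A ξ * B ξ) = ∑ x, ∑ y, S ξ * ((f x : ℂ) * ψ (1 * ∑ j, ξ j * x j) * ((g y : ℂ) * ψ (-1 * ∑ j, ξ j * y j))) := by
      intro ξ
      simp only [hA, hB]
      rw [Finset.sum_mul_sum, Finset.mul_sum]
      simp only [Finset.mul_sum]
    simp only [h3]
    conv_rhs => rw [Finset.sum_comm]
    refine Finset.sum_congr rfl fun x _ => ?_
    conv_rhs => rw [Finset.sum_comm]
    refine Finset.sum_congr rfl fun y _ => ?_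
    rw [← h1]
    split_ifs <;> simp
  have hn := congrArg norm key
  rw [norm_mul, norm_pow, norm_mul, eta_norm (neg_ne_zero.2 one_ne_zero), one_mul, gauss_norm h2 hψ, ← hr,
    Complex.norm_real, norm_mul, Real.norm_natCast, Real.norm_eq_abs, ← hrr] at hn
  have hAB : ‖∑ ξ, S ξ * (A ξ * B ξ)‖ ≤ 2 * r * (r ^ (2 * d) * (Real.sqrt (∑ x, f x ^ 2) * Real.sqrt (∑ y, g y ^ 2))) := by
    calc ‖∑ ξ, S ξ * (A ξ * B ξ)‖ ≤ ∑ ξ, ‖S ξ * (A ξ * B ξ)‖ := norm_sum_le _ _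
      _ ≤ ∑ ξ, 2 * r * (‖A ξ‖ * ‖B ξ‖) := by
          refine Finset.sum_le_sum fun ξ _ => ?_
          rw [norm_mul, norm_mul]
          exact mul_le_mul_of_nonneg_right (S_bound h2 hψ d _) (by positivity)
      _ = 2 * r * ∑ ξ, ‖A ξ‖ * ‖B ξ‖ := by rw [Finset.mul_sum]
      _ ≤ 2 * r * (Real.sqrt (∑ ξ, ‖A ξ‖ ^ 2) * Real.sqrt (∑ ξ, ‖B ξ‖ ^ 2)) := by
          refine mul_le_mul_of_nonneg_left (Real.sum_mul_le_sqrt_mul_sqrt _ _ _) (by positivity)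
      _ = _ := by
          have hp1 := plancherel hψ f 1 one_ne_zero
          have hp2 := plancherel hψ g (-1) (neg_ne_zero.2 one_ne_zero)
          simp only [hA, hB]
          rw [hp1, hp2, ← hrr, Real.sqrt_mul (by positivity), Real.sqrt_mul (by positivity), ← pow_mul, mul_comm 2 d,
            pow_mul, Real.sqrt_sq (by positivity)]
          ring
  rw [← hn] at hAB
  have hpos : 0 < r ^ (d + 1) := by positivity
  refine le_of_mul_le_mul_left ?_ hpos
  calc r ^ (d + 1) * (|D| * r) = r ^ d * (r ^ 2 * |D|) := by ring
    _ ≤ _ := hAB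
    _ = _ := by ring
end fourier
section comb
variable {V : Type} [Fintype V] [DecidableEq V]

/-- path set -/
def PS (E : Finset V) (adj : V → V → Prop) [DecidableRel adj] (k : ℕ) : Finset (Fin (k + 1) → V) :=
  Finset.univ.filter (fun x : Fin (k + 1) → V =>
    Function.Injective x ∧ (∀ i, x i ∈ E) ∧ ∀ i : Fin k, adj (x i.castSucc) (x i.succ))

variable (E : Finset V) (adj : V → V → Prop) [DecidableRel adj]

lemma snoc_mem (k : ℕ) (p : Fin (k + 1) → V) (y : V) :
    (Fin.snoc p y : Fin (k + 1 + 1) → V) ∈ PS E adj (k + 1) ↔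
      p ∈ PS E adj k ∧ y ∈ E ∧ adj (p (Fin.last k)) y ∧ ∀ i, p i ≠ y := by
  simp only [PS, Finset.mem_filter, Finset.mem_univ, true_and]
  rw [Fin.snoc_injective_iff, Fin.forall_fin_succ' (P := fun i => (Fin.snoc p y : Fin (k + 1 + 1) → V) i ∈ E)]
  rw [Fin.forall_fin_succ' (P := fun i : Fin (k + 1) => adj ((Fin.snoc p y : Fin (k + 1 + 1) → V) i.castSucc)
    ((Fin.snoc p y : Fin (k + 1 + 1) → V) i.succ))]
  simp only [Fin.snoc_castSucc, Fin.snoc_last, Fin.succ_castSucc, Fin.succ_last, Set.mem_range, not_exists]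
  tauto

/-- number of paths with given endpoint -/
def fe (k : ℕ) (y : V) : ℝ := (((PS E adj k).filter fun p => p (Fin.last k) = y).card : ℝ)

lemma fe_succ (k : ℕ) (y : V) : fe E adj (k + 1) y =
    (((PS E adj k).filter fun p => y ∈ E ∧ adj (p (Fin.last k)) y ∧ ∀ i, p i ≠ y).card : ℝ) := by
  rw [fe]
  congr 1
  refine Finset.card_bij' (fun p _ => Fin.init p) (fun p _ => Fin.snoc p y) ?_ ?_ ?_ ?_
  · intro p hp
    rw [Finset.mem_filter] at hp ⊢
    have h := (snoc_mem E adj k (Fin.init p) (p (Fin.last _))).1 (by rw [Fin.snoc_init_self]; exact hp.1)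
    rw [hp.2] at h
    exact h
  · intro p hp
    rw [Finset.mem_filter] at hp ⊢
    exact ⟨(snoc_mem E adj k p y).2 hp, by simp⟩
  · intro p hp
    rw [Finset.mem_filter] at hp
    rw [← hp.2]
    exact Fin.snoc_init_self p
  · intro p hp
    exact Fin.init_snoc (α := fun _ => V) y p

lemma sum_fe_mul (k : ℕ) (φ : V → ℝ) : ∑ x, fe E adj k x * φ x = ∑ p ∈ PS E adj k, φ (p (Fin.last k)) := by
  rw [← Finset.sum_fiberwise (PS E adj k) (fun p => p (Fin.last k))]
  refine Finset.sum_congr rfl fun x _ => ?_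
  rw [Finset.sum_congr rfl (g := fun _ => φ x), Finset.sum_const, nsmul_eq_mul, fe]
  intro p hp
  rw [(Finset.mem_filter.1 hp).2]

lemma sum_fe (k : ℕ) : ∑ x, fe E adj k x = ((PS E adj k).card : ℝ) := by
  have := sum_fe_mul E adj k (fun _ => 1)
  simpa using this

lemma fe_nonneg (k : ℕ) (x : V) : 0 ≤ fe E adj k x := Nat.cast_nonneg _

lemma fe_supp (k : ℕ) (x : V) (hx : x ∉ E) : fe E adj k x = 0 := by
  rw [fe]
  norm_cast
  rw [Finset.card_eq_zero, Finset.filter_eq_empty_iff]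
  intro p hp h
  rw [PS, Finset.mem_filter] at hp
  exact hx (h ▸ hp.2.2.1 _)

lemma fe_succ_le (k : ℕ) (y : V) : fe E adj (k + 1) y ≤ ∑ x, fe E adj k x * (if adj x y then 1 else 0) := by
  rw [sum_fe_mul E adj k (fun x => if adj x y then 1 else 0), fe_succ, Finset.sum_boole]
  exact_mod_cast Finset.card_le_card (fun p hp => by
    rw [Finset.mem_filter] at hp ⊢
    exact ⟨hp.1, hp.2.2.1⟩)

lemma G_succ_ge (k : ℕ) :
    ∑ x, ∑ y, fe E adj k x * (if y ∈ E then 1 else 0) * (if adj x y then 1 else 0) - (k + 1) * ((PS E adj k).card : ℝ)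
      ≤ ((PS E adj (k + 1)).card : ℝ) := by
  have h1 : ∑ x, ∑ y, fe E adj k x * (if y ∈ E then 1 else 0) * (if adj x y then 1 else 0) =
      ∑ p ∈ PS E adj k, ∑ y, (if y ∈ E then (1 : ℝ) else 0) * (if adj (p (Fin.last k)) y then 1 else 0) := by
    rw [← sum_fe_mul E adj k (fun x => ∑ y, (if y ∈ E then (1 : ℝ) else 0) * (if adj x y then 1 else 0))]
    refine Finset.sum_congr rfl fun x _ => ?_
    rw [Finset.mul_sum]
    exact Finset.sum_congr rfl fun y _ => by ring
  have h2 : ((PS E adj (k + 1)).card : ℝ) = ∑ p ∈ PS E adj k, ∑ y, (if y ∈ E ∧ adj (p (Fin.last k)) y ∧ ∀ i, p i ≠ y then (1 : ℝ) else 0) := by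
    rw [← sum_fe, Finset.sum_comm]
    refine Finset.sum_congr rfl fun y _ => ?_
    rw [fe_succ, Finset.sum_boole]
  have h3 : (k + 1) * ((PS E adj k).card : ℝ) = ∑ p ∈ PS E adj k, ∑ y : V, ∑ i : Fin (k + 1), (if p i = y then (1 : ℝ) else 0) := by
    have : ∀ p : Fin (k + 1) → V, ∑ y : V, ∑ i : Fin (k + 1), (if p i = y then (1 : ℝ) else 0) = k + 1 := by
      intro p
      rw [Finset.sum_comm]
      simp
    simp only [this, Finset.sum_const, nsmul_eq_mul]
    ring
  rw [h1, h2, h3, ← Finset.sum_sub_distrib]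
  refine Finset.sum_le_sum fun p _ => ?_
  rw [← Finset.sum_sub_distrib]
  refine Finset.sum_le_sum fun y _ => ?_
  have hnn : ∀ i ∈ Finset.univ, (0 : ℝ) ≤ (if p i = y then (1 : ℝ) else 0) := fun i _ => by split_ifs <;> norm_num
  have hs := Finset.sum_nonneg hnn
  by_cases hA : ∀ i, p i ≠ y
  · by_cases h4 : y ∈ E <;> by_cases h5 : adj (p (Fin.last k)) y <;> simp [h4, h5, hA]
  · push Not at hA
    obtain ⟨i, hi⟩ := hA
    have h6 := Finset.single_le_sum hnn (Finset.mem_univ i)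
    rw [if_pos hi] at h6
    have h7 : (if y ∈ E then (1 : ℝ) else 0) * (if adj (p (Fin.last k)) y then 1 else 0) ≤ 1 := by
      split_ifs <;> norm_num
    have h8 : (0 : ℝ) ≤ (if y ∈ E ∧ adj (p (Fin.last k)) y ∧ ∀ i, p i ≠ y then (1 : ℝ) else 0) := by
      split_ifs <;> norm_num
    linarith

theorem path_lower (q lam : ℝ) (hlam : 0 ≤ lam) (hq : 0 < q)
    (hb : ∀ f g : V → ℝ, |∑ x, ∑ y, f x * g y * (if adj x y then 1 else 0) - (∑ x, f x) * (∑ y, g y) / q| ≤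
      lam * (Real.sqrt (∑ x, f x ^ 2) * Real.sqrt (∑ y, g y ^ 2)))
    (K : ℕ) (M θ : ℝ) (hn : 0 < E.card) (hM : ∀ j ≤ K, ((E.card : ℝ) / q + lam) ^ j ≤ M * ((E.card : ℝ) / q) ^ j)
    (hθ : lam + K ≤ (E.card : ℝ) / q * θ) :
    (E.card : ℝ) * ((E.card : ℝ) / q) ^ K * (1 - K * θ * M) ≤ ((PS E adj K).card : ℝ) := by
  set n : ℝ := (E.card : ℝ) with hnd
  set δ := n / q with hδ
  have hn0 : 0 < n := by rw [hnd]; exact_mod_cast hn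
  have hδ0 : 0 < δ := div_pos hn0 hq
  set ind : V → ℝ := fun y => if y ∈ E then 1 else 0 with hind
  have hi1 : ∑ y, ind y = n := by simp [hind, hnd]
  have hi2 : ∑ y, ind y ^ 2 = n := by simp [hind, hnd]
  set N : ℕ → ℝ := fun j => Real.sqrt (∑ x, fe E adj j x ^ 2) with hN
  have hNN : ∀ j, N j * N j = ∑ x, fe E adj j x ^ 2 := fun j =>
    Real.mul_self_sqrt (Finset.sum_nonneg fun _ _ => sq_nonneg _)
  have hN0 : ∀ j, 0 ≤ N j := fun j => Real.sqrt_nonneg _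
  have hsn : Real.sqrt n * Real.sqrt n = n := Real.mul_self_sqrt hn0.le
  have hG : ∀ j, ((PS E adj j).card : ℝ) ≤ Real.sqrt n * N j := by
    intro j
    rw [← sum_fe]
    have h := Real.sum_mul_le_sqrt_mul_sqrt Finset.univ ind (fe E adj j)
    rw [hi2] at h
    refine le_trans (le_of_eq ?_) h
    refine Finset.sum_congr rfl fun x _ => ?_
    by_cases hx : x ∈ E
    · simp [hind, hx]
    · rw [fe_supp E adj j x hx, mul_zero]
  have hstep : ∀ j, N (j + 1) ≤ (δ + lam) * N j := by
    intro j
    have h1 : N (j + 1) * N (j + 1) ≤ ∑ x, ∑ y, fe E adj j x * fe E adj (j + 1) y * (if adj x y then 1 else 0) := by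
      rw [hNN, Finset.sum_comm]
      refine Finset.sum_le_sum fun y _ => ?_
      have := mul_le_mul_of_nonneg_left (fe_succ_le E adj j y) (fe_nonneg E adj (j + 1) y)
      rw [sq]
      refine this.trans (le_of_eq ?_)
      rw [Finset.mul_sum]
      exact Finset.sum_congr rfl fun x _ => by ring
    have h2 := (abs_le.1 (hb (fe E adj j) (fe E adj (j + 1)))).2
    have h3 : (∑ x, fe E adj j x) * (∑ y, fe E adj (j + 1) y) / q ≤ δ * (N j * N (j + 1)) := by
      rw [sum_fe, sum_fe, hδ, div_mul_eq_mul_div]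
      refine div_le_div_of_nonneg_right ?_ hq.le
      calc ((PS E adj j).card : ℝ) * ((PS E adj (j + 1)).card : ℝ) ≤ (Real.sqrt n * N j) * (Real.sqrt n * N (j + 1)) :=
            mul_le_mul (hG j) (hG (j + 1)) (Nat.cast_nonneg _) (mul_nonneg (Real.sqrt_nonneg _) (hN0 j))
        _ = (Real.sqrt n * Real.sqrt n) * (N j * N (j + 1)) := by ring
        _ = _ := by rw [hsn]
    have h4 : N (j + 1) * N (j + 1) ≤ ((δ + lam) * N j) * N (j + 1) := by
      have : lam * (Real.sqrt (∑ x, fe E adj j x ^ 2) * Real.sqrt (∑ y, fe E adj (j + 1) y ^ 2)) = lam * (N j * N (j + 1)) := rfl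
      rw [this] at h2
      nlinarith
    rcases (hN0 (j + 1)).eq_or_lt with h5 | h5
    · rw [← h5]; exact mul_nonneg (by positivity) (hN0 j)
    · exact le_of_mul_le_mul_right h4 h5
  have hN00 : N 0 ≤ Real.sqrt n := by
    refine Real.sqrt_le_sqrt ?_
    rw [← hi2]
    refine Finset.sum_le_sum fun x _ => ?_
    by_cases hx : x ∈ E
    · have h1 : fe E adj 0 x ≤ 1 := by
        rw [fe]
        norm_cast
        rw [Finset.card_le_one]
        intro p hp p' hp'
        rw [Finset.mem_filter] at hp hp'
        funext i
        have : i = Fin.last 0 := by ext; have := i.isLt; simp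
        rw [this, hp.2, hp'.2]
      have h0 := fe_nonneg E adj 0 x
      simp only [hind, hx, if_true]
      nlinarith
    · rw [fe_supp E adj 0 x hx]; simp [hind, hx]
  have hNj : ∀ j, N j ≤ (δ + lam) ^ j * Real.sqrt n := by
    intro j
    induction j with
    | zero => simpa using hN00
    | succ j ih =>
      refine (hstep j).trans ?_
      rw [pow_succ', mul_assoc]
      exact mul_le_mul_of_nonneg_left ih (by positivity)
  have main : ∀ j ≤ K, n * δ ^ j * (1 - j * θ * M) ≤ ((PS E adj j).card : ℝ) := by
    intro j
    induction j with
    | zero =>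
      intro _
      have : ((PS E adj 0).card : ℝ) = n := by
        rw [hnd]
        congr 1
        refine Finset.card_bij' (fun p _ => p 0) (fun x _ => fun _ => x) ?_ ?_ ?_ ?_
        · intro p hp
          rw [PS, Finset.mem_filter] at hp
          exact hp.2.2.1 0
        · intro x hx
          rw [PS, Finset.mem_filter]
          exact ⟨Finset.mem_univ _, fun i j _ => by ext; have := i.isLt; have := j.isLt; omega, fun _ => hx, fun i => i.elim0⟩
        · intro p hp
          funext i
          have : i = 0 := by ext; have := i.isLt; simp
          rw [this]
        · intro x hx; rfl
      rw [this]; simp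
    | succ j ih =>
      intro hj
      have ih := ih (by omega)
      have h1 := G_succ_ge E adj j
      have h2 := (abs_le.1 (hb (fe E adj j) ind)).1
      rw [hi2, hi1, sum_fe] at h2
      change -(lam * (N j * Real.sqrt n)) ≤ _ at h2
      have hA : N j * Real.sqrt n ≤ n * (M * δ ^ j) := by
        calc N j * Real.sqrt n ≤ ((δ + lam) ^ j * Real.sqrt n) * Real.sqrt n :=
              mul_le_mul_of_nonneg_right (hNj j) (Real.sqrt_nonneg _)
          _ = n * (δ + lam) ^ j := by rw [mul_assoc, hsn]; ring
          _ ≤ _ := mul_le_mul_of_nonneg_left (hM j (by omega)) hn0.le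
      have hB : ((PS E adj j).card : ℝ) ≤ n * (M * δ ^ j) := (hG j).trans ((mul_comm _ _).trans_le hA)
      have hX0 : 0 ≤ n * (M * δ ^ j) := le_trans (Nat.cast_nonneg _) hB
      have hjK : ((j : ℝ) + 1) ≤ K := by exact_mod_cast hj
      have h3 : lam * (N j * Real.sqrt n) + (j + 1) * ((PS E adj j).card : ℝ) ≤ δ * θ * (n * (M * δ ^ j)) := by
        calc _ ≤ lam * (n * (M * δ ^ j)) + K * (n * (M * δ ^ j)) := by
              refine add_le_add (mul_le_mul_of_nonneg_left hA hlam) ?_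
              exact mul_le_mul hjK hB (Nat.cast_nonneg _) (Nat.cast_nonneg _)
          _ = (lam + K) * (n * (M * δ ^ j)) := by ring
          _ ≤ _ := mul_le_mul_of_nonneg_right hθ hX0
      have h4 : ((PS E adj j).card : ℝ) * n / q = δ * ((PS E adj j).card : ℝ) := by rw [hδ]; ring
      rw [h4] at h2
      have h5 := mul_le_mul_of_nonneg_left ih hδ0.le
      push_cast
      have h6 : n * δ ^ (j + 1) * (1 - (j + 1) * θ * M) = δ * (n * δ ^ j * (1 - j * θ * M)) - δ * θ * (n * (M * δ ^ j)) := by ring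
      rw [h6]
      have h7 : ∑ x, ∑ y, fe E adj j x * (if y ∈ E then 1 else 0) * (if adj x y then 1 else 0) =
        ∑ x, ∑ y, fe E adj j x * ind y * (if adj x y then 1 else 0) := rfl
      rw [h7] at h1
      linarith
  exact main K le_rfl
end comb
end KL

theorem statement13 {F : Type} [Field F] [Fintype F] [DecidableEq F]
    (q : ℕ) (hq : Fintype.card F = q) (hodd : Odd q)
    (d : ℕ) (hd : 2 ≤ d)
    (E : Finset (Fin d → F)) (k : ℕ)
    (hE : (4 * (k : ℝ) / Real.log 2) * (q : ℝ) ^ (((d : ℝ) + 1) / 2) ≤ (E.card : ℝ)) :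
    (E.card : ℝ) ^ (k + 1) / (q : ℝ) ^ k -
        (4 * (k : ℝ) / Real.log 2) * (q : ℝ) ^ (((d : ℝ) + 1) / 2) *
          ((E.card : ℝ) ^ k / (q : ℝ) ^ k) ≤
      (pathCount E k : ℝ) := by
  have h2 : ringChar F ≠ 2 := by
    intro h
    have := FiniteField.even_card_iff_char_two.1 h
    rw [hq] at this
    rw [Nat.odd_iff] at hodd
    omega
  have hqpos : 0 < q := hodd.pos
  have hqR : (0 : ℝ) < q := by exact_mod_cast hqpos
  set r := Real.sqrt q with hr
  have hr0 : 0 < r := Real.sqrt_pos.2 hqR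
  have hrr : r ^ 2 = q := Real.sq_sqrt hqR.le
  have hQ : (q : ℝ) ^ (((d : ℝ) + 1) / 2) = r ^ (d + 1) := by
    rw [hr, Real.sqrt_eq_rpow, ← Real.rpow_natCast, ← Real.rpow_mul hqR.le]
    congr 1; push_cast; ring
  rw [hQ] at hE ⊢
  set n : ℝ := (E.card : ℝ) with hn
  have hn_nonneg : 0 ≤ n := Nat.cast_nonneg _
  have hL : 0 < Real.log 2 := Real.log_pos (by norm_num)
  have hL1 : Real.log 2 < 0.6931471808 := Real.log_two_lt_d9
  rcases Nat.eq_zero_or_pos E.card with hE0 | hE0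
  · have hn0 : n = 0 := by rw [hn, hE0]; simp
    rw [hn0]
    have h1 : (0 : ℝ) ≤ (4 * (k : ℝ) / Real.log 2) * r ^ (d + 1) * (0 ^ k / (q : ℝ) ^ k) := by positivity
    have h3 : (0 : ℝ) ^ (k + 1) / (q : ℝ) ^ k = 0 := by simp
    have h4 : (0 : ℝ) ≤ (pathCount E k : ℝ) := Nat.cast_nonneg _
    linarith
  have hn0 : 0 < n := by rw [hn]; exact_mod_cast hE0
  set adj : (Fin d → F) → (Fin d → F) → Prop := fun x y => ∑ j, (x j - y j) ^ 2 = 1 with hadj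
  letI hdec : DecidableRel adj := fun x y => inferInstanceAs (Decidable (_ = _))
  have hPC : pathCount E k = (KL.PS E adj k).card := by
    unfold pathCount KL.PS
    congr
  set lam : ℝ := 2 * r ^ d / r with hlam
  have hlam0 : 0 ≤ lam := by positivity
  set τ : ℝ := 2 * r ^ (d + 1) / n with hτ
  have hτ0 : 0 ≤ τ := by positivity
  have hlt : lam = n / q * τ := by
    rw [hlam, hτ, ← hrr]; field_simp; ring
  have hkτ : k * τ ≤ Real.log 2 / 2 := by
    rw [hτ, ← mul_div_assoc, div_le_iff₀ hn0]
    rw [div_mul_eq_mul_div, div_le_iff₀ hL] at hE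
    linarith
  have hM : ∀ j ≤ k, (n / q + lam) ^ j ≤ 3 / 2 * (n / q) ^ j := by
    intro j hj
    have e : n / q + lam = (1 + τ) * (n / q) := by rw [hlt]; ring
    rw [e, mul_pow]
    refine mul_le_mul_of_nonneg_right ?_ (by positivity)
    calc (1 + τ) ^ j ≤ (1 + τ) ^ k := pow_le_pow_right₀ (by linarith) hj
      _ ≤ (Real.exp τ) ^ k := pow_le_pow_left₀ (by linarith) (by linarith [Real.add_one_le_exp τ]) _
      _ = Real.exp (k * τ) := by rw [← Real.exp_nat_mul]
      _ ≤ Real.exp (Real.log 2 / 2) := Real.exp_le_exp.2 hkτ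
      _ ≤ 3 / 2 := by
          have h : Real.exp (Real.log 2 / 2) ^ 2 = 2 := by
            rw [← Real.exp_nat_mul]
            push_cast
            rw [mul_div_cancel₀ _ (two_ne_zero), Real.exp_log (by norm_num)]
          nlinarith [Real.exp_pos (Real.log 2 / 2)]
  have hnle : n ≤ r ^ (2 * d) := by
    have h1 : E.card ≤ q ^ d := by
      have := Finset.card_le_univ E
      rwa [Fintype.card_fun, Fintype.card_fin, hq] at this
    rw [pow_mul, hrr, hn]
    exact_mod_cast h1
  have hkle : (k : ℝ) ≤ n / q * (τ / 2) := by
    have h1 : n / q * (τ / 2) = r ^ d / r := by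
      have : n / q * (τ / 2) = lam / 2 := by rw [hlt]; ring
      rw [this, hlam]; ring
    rw [h1, le_div_iff₀ hr0]
    have h3 : 4 * (k : ℝ) / Real.log 2 * r ^ (d + 1) ≤ r ^ (2 * d) := hE.trans hnle
    have h4 : (k : ℝ) ≤ 4 * (k : ℝ) / Real.log 2 := by
      rw [le_div_iff₀ hL]
      have : (0 : ℝ) ≤ k := Nat.cast_nonneg _
      nlinarith
    have h5 : (k : ℝ) * r ^ (d + 1) ≤ r ^ (2 * d) := (mul_le_mul_of_nonneg_right h4 (by positivity)).trans h3
    have h6 : 0 < r ^ d := by positivity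
    refine le_of_mul_le_mul_right ?_ h6
    calc (k : ℝ) * r * r ^ d = k * r ^ (d + 1) := by ring
      _ ≤ r ^ (2 * d) := h5
      _ = r ^ d * r ^ d := by ring
  have hfin := KL.path_lower E adj q lam hlam0 hqR (by
    intro f g
    have h := KL.bilin h2 f g
    rw [hq, ← hr] at h
    rw [hlam, div_mul_eq_mul_div, le_div_iff₀ hr0]
    exact h) k (3 / 2) (3 / 2 * τ) hE0 hM (by
      rw [← hn]
      linarith)
  rw [hPC]
  refine le_trans ?_ hfin
  rw [← hn]
  have e1 : n ^ (k + 1) / (q : ℝ) ^ k - (4 * (k : ℝ) / Real.log 2) * r ^ (d + 1) * (n ^ k / (q : ℝ) ^ k) =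
      n * (n / q) ^ k * (1 - 2 / Real.log 2 * (k * τ)) := by
    rw [hτ, div_pow]; field_simp; ring
  rw [e1]
  refine mul_le_mul_of_nonneg_left ?_ (by positivity)
  have h7 : (9 / 4 : ℝ) ≤ 2 / Real.log 2 := by
    rw [le_div_iff₀ hL]; linarith
  have h8 : 0 ≤ (k : ℝ) * τ := by positivity
  nlinarith
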